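/- Let a, b ∈ ℂ with Re a > 0 and Re b > 0, and let g(x) = 1/(e^{ax} + e^{-bx}). If Λ ⊂ ℝ is a separated set with D⁺(Λ) < 1, then there exists a set Λ' ⊂ ℝ containing Λ which is a complete interpolating sequence for V²(g). -/

import Mathlib

open MeasureTheory Filter Metric Complex

noncomputable section

/-- A set `Λ ⊆ ℝ` is separated. -/
def Separated (Λ : Set ℝ) : Prop :=
  ∃ δ : ℝ, 0 < δ ∧ ∀ x ∈ Λ, ∀ y ∈ Λ, x ≠ y → δ ≤ |x - y|

/-- Lower Beurling density. -/
def lowerDensity (Λ : Set ℝ) : ℝ :=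
  liminf (fun r : ℝ => ⨅ x : ℝ, ((Λ ∩ Set.Icc x (x + r)).ncard : ℝ) / r) atTop

def upperDensity (Λ : Set ℝ) : ℝ :=
  limsup (fun r : ℝ => ⨆ x : ℝ, ((Λ ∩ Set.Icc x (x + r)).ncard : ℝ) / r) atTop

/-- Gabor coefficient. -/
def gaborCoef (g f : ℝ → ℂ) (p : ℝ × ℝ) : ℂ :=
  ∫ t : ℝ, f t * (starRingEnd ℂ) (Complex.exp (-2 * Real.pi * Complex.I * p.2 * t) * g (p.1 - t))

def IsGaborFrame (g : ℝ → ℂ) (S : Set (ℝ × ℝ)) : Prop :=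
  ∃ A B : ℝ, 0 < A ∧ 0 < B ∧ ∀ f : ℝ → ℂ, MemLp f 2 (volume : Measure ℝ) →
    A * (∫ t : ℝ, ‖f t‖ ^ 2) ≤ (∑' p : S, ‖gaborCoef g f p‖ ^ 2) ∧
    (∑' p : S, ‖gaborCoef g f p‖ ^ 2) ≤ B * (∫ t : ℝ, ‖f t‖ ^ 2)

/-- membership in shift invariant space -/
def InV2 (g : ℝ → ℂ) (f : ℝ → ℂ) : Prop :=
  ∃ c : ℤ → ℂ, Memℓp c 2 ∧ ∀ x : ℝ, HasSum (fun n : ℤ => c n * g (x - n)) (f x)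

def IsSamplingSet (g : ℝ → ℂ) (Λ : Set ℝ) : Prop :=
  ∃ A B : ℝ, 0 < A ∧ 0 < B ∧ ∀ f : ℝ → ℂ, InV2 g f →
    A * (∫ t : ℝ, ‖f t‖ ^ 2) ≤ (∑' l : Λ, ‖f l‖ ^ 2) ∧
    (∑' l : Λ, ‖f l‖ ^ 2) ≤ B * (∫ t : ℝ, ‖f t‖ ^ 2)

def IsInterpolatingSet (g : ℝ → ℂ) (Λ : Set ℝ) : Prop :=
  ∀ a : Λ → ℂ, Memℓp a 2 → ∃ f : ℝ → ℂ, InV2 g f ∧ ∀ l : Λ, f l = a l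

def IsSamplingSeqV (g : ℝ → ℂ) (lam : ℤ → ℝ) : Prop :=
  ∃ A B : ℝ, 0 < A ∧ 0 < B ∧ ∀ f : ℝ → ℂ, InV2 g f →
    A * (∫ t : ℝ, ‖f t‖ ^ 2) ≤ (∑' m : ℤ, ‖f (lam m)‖ ^ 2) ∧
    (∑' m : ℤ, ‖f (lam m)‖ ^ 2) ≤ B * (∫ t : ℝ, ‖f t‖ ^ 2)

/-- Fock weight function φ. -/
def phiF (β γ : ℝ) (z : ℂ) : ℝ :=
  β * (Real.log ‖z‖) ^ 2 + γ * Real.log ‖z‖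

def MemFock (β γ : ℝ) (F : ℂ → ℂ) : Prop :=
  DifferentiableOn ℂ F {(0 : ℂ)}ᶜ ∧
    Integrable (fun z : ℂ => ‖F z‖ ^ 2 * Real.exp (-2 * phiF β γ z)) volume

def fockNormSq (β γ : ℝ) (F : ℂ → ℂ) : ℝ :=
  (1 / Real.pi) * ∫ z : ℂ, ‖F z‖ ^ 2 * Real.exp (-2 * phiF β γ z)

def fockWeight (β γ : ℝ) (w : ℂ) : ℝ :=
  (1 + ‖w‖ ^ 2) * Real.exp (-2 * phiF β γ w)

def IsFockSamplingSeq (β γ : ℝ) (u : ℤ → ℂ) : Prop :=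
  ∃ A B : ℝ, 0 < A ∧ 0 < B ∧ ∀ F : ℂ → ℂ, MemFock β γ F →
    A * fockNormSq β γ F ≤ (∑' m : ℤ, fockWeight β γ (u m) * ‖F (u m)‖ ^ 2) ∧
    (∑' m : ℤ, fockWeight β γ (u m) * ‖F (u m)‖ ^ 2) ≤ B * fockNormSq β γ F

def IsFockInterpolatingSeq (β γ : ℝ) (u : ℤ → ℂ) : Prop :=
  ∀ a : ℤ → ℂ, Summable (fun m : ℤ => fockWeight β γ (u m) * ‖a m‖ ^ 2) →
    ∃ F : ℂ → ℂ, MemFock β γ F ∧ ∀ m : ℤ, F (u m) = a m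

def IsFockSamplingSet (β γ : ℝ) (Λ : Set ℂ) : Prop :=
  ∃ A B : ℝ, 0 < A ∧ 0 < B ∧ ∀ F : ℂ → ℂ, MemFock β γ F →
    A * fockNormSq β γ F ≤ (∑' w : Λ, fockWeight β γ w * ‖F w‖ ^ 2) ∧
    (∑' w : Λ, fockWeight β γ w * ‖F w‖ ^ 2) ≤ B * fockNormSq β γ F

def IsFockInterpolatingSet (β γ : ℝ) (Λ : Set ℂ) : Prop :=
  ∀ a : Λ → ℂ, Summable (fun w : Λ => fockWeight β γ (w : ℂ) * ‖a w‖ ^ 2) →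
    ∃ F : ℂ → ℂ, MemFock β γ F ∧ ∀ w : Λ, F w = a w

/-- the canonical product A(z) -/
def Afun (a b : ℂ) (z : ℂ) : ℂ :=
  ∏' n : ℕ, (1 + z * Complex.exp (-(a + b) * (n + 1)))

def Gfun (a b : ℂ) (z : ℂ) : ℂ := (1 + z) * Afun a b z * Afun a b (1 / z)

/-- the discrete Cauchy transform G(z) Σ c_n e^{an}/(z+e^{(a+b)n}) -/
def cauchyT (a b : ℂ) (c : ℤ → ℂ) (z : ℂ) : ℂ :=
  Gfun a b z * ∑' n : ℤ, c n * Complex.exp (a * n) / (z + Complex.exp ((a + b) * n))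

/-- norm of the evaluation functional at `w` on `H_{a,b}` -/
def Hnorm (a b : ℂ) (w : ℂ) : ℝ :=
  sSup {r : ℝ | ∃ c : ℤ → ℂ, Memℓp c 2 ∧ (∑' n : ℤ, ‖c n‖ ^ 2) ≤ 1 ∧ r = ‖cauchyT a b c w‖}

def IsSamplingSeqH (a b : ℂ) (u : ℤ → ℂ) : Prop :=
  ∃ A B : ℝ, 0 < A ∧ 0 < B ∧ ∀ c : ℤ → ℂ, Memℓp c 2 →
    A * (∑' n : ℤ, ‖c n‖ ^ 2) ≤ (∑' m : ℤ, ((Hnorm a b (u m)) ^ 2)⁻¹ * ‖cauchyT a b c (u m)‖ ^ 2) ∧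
    (∑' m : ℤ, ((Hnorm a b (u m)) ^ 2)⁻¹ * ‖cauchyT a b c (u m)‖ ^ 2) ≤ B * (∑' n : ℤ, ‖c n‖ ^ 2)

/-! ### Inverses of finite Cauchy matrices -/

/-- The entries of the inverse of the finite Cauchy matrix `1 / (w m + s n)`, `m, n ∈ I`. -/
def cauchyInv {ι : Type*} [DecidableEq ι] (I : Finset ι) (w s : ι → ℂ) (n m : ι) : ℂ :=
  (∏ k ∈ I, (w m + s k)) * (∏ k ∈ I.erase m, (-s n - w k)) /
    ((∏ k ∈ I.erase m, (w m - w k)) * ∏ k ∈ I.erase n, (s k - s n))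

lemma sum_cauchy_mul_cauchyInv {ι : Type*} [DecidableEq ι] (I : Finset ι) (w s : ι → ℂ)
    (hw : Set.InjOn w I) (hs : Set.InjOn s I) (hws : ∀ m ∈ I, ∀ n ∈ I, w m + s n ≠ 0)
    {m m' : ι} (hm : m ∈ I) (hm' : m' ∈ I) :
    ∑ n ∈ I, 1 / (w m + s n) * cauchyInv I w s n m' = if m = m' then 1 else 0 := by
  have hv : Set.InjOn (fun k => -s k) (I : Set ι) := fun x hx y hy h => hs hx hy (neg_injective h)
  have hdeg : (Lagrange.nodal (I.erase m') w).degree < (I.card : ℕ) := by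
    rw [Lagrange.degree_nodal]
    exact_mod_cast Finset.card_erase_lt_of_mem hm'
  have hnorm := Lagrange.eq_interpolate (v := fun k => -s k) hv hdeg
  have hev := congrArg (Polynomial.eval (w m)) hnorm
  rw [Lagrange.eval_interpolate_not_at_node _
    (fun i hi h => hws m hm i hi (by rw [h]; ring))] at hev
  simp only [Lagrange.eval_nodal, Lagrange.nodalWeight] at hev
  have hE : ∏ k ∈ I, (w m - -s k) ≠ 0 :=
    Finset.prod_ne_zero_iff.2 fun k hk => by simpa using hws m hm k hk
  have hQ : ∏ k ∈ I.erase m', (w m' - w k) ≠ 0 :=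
    Finset.prod_ne_zero_iff.2 fun k hk => sub_ne_zero.2 fun h =>
      (Finset.ne_of_mem_erase hk) (hw (Finset.mem_of_mem_erase hk) hm' h.symm)
  have hsum : ∑ n ∈ I, 1 / (w m + s n) * cauchyInv I w s n m' =
      (∏ k ∈ I, (w m' + s k)) / (∏ k ∈ I.erase m', (w m' - w k)) *
        ∑ n ∈ I, (∏ j ∈ I.erase n, (-s n - -s j)⁻¹) * (w m - -s n)⁻¹ *
          ∏ k ∈ I.erase m', (-s n - w k) := by
    rw [Finset.mul_sum]
    refine Finset.sum_congr rfl fun n _ => ?_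
    have h1 : ∏ j ∈ I.erase n, (-s n - -s j)⁻¹ = (∏ j ∈ I.erase n, (s j - s n))⁻¹ := by
      rw [← Finset.prod_inv_distrib]
      exact Finset.prod_congr rfl fun j _ => by congr 1; ring
    rw [h1, cauchyInv, sub_neg_eq_add]
    simp only [div_eq_mul_inv, mul_inv, one_mul]
    ring
  rw [hsum]
  split_ifs with h
  · subst h
    rw [div_mul_eq_mul_div, div_eq_one_iff_eq hQ, hev]
    simp only [sub_neg_eq_add]
  · have h0 : ∏ k ∈ I.erase m', (w m - w k) = 0 :=
      Finset.prod_eq_zero (Finset.mem_erase.2 ⟨h, hm⟩) (sub_self _)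
    rw [h0] at hev
    rw [(mul_eq_zero.1 hev.symm).resolve_left hE, mul_zero]

/-- A right inverse of a square matrix indexed by a finset is a left inverse. -/
lemma sum_mul_eq_ite_comm {ι : Type*} [DecidableEq ι] (I : Finset ι) (A H : ι → ι → ℂ)
    (h : ∀ m ∈ I, ∀ m' ∈ I, ∑ n ∈ I, A m n * H n m' = if m = m' then 1 else 0) :
    ∀ m ∈ I, ∀ m' ∈ I, ∑ n ∈ I, H m n * A n m' = if m = m' then 1 else 0 := by
  have h1 : (Matrix.of fun i j : I => A i j) * (Matrix.of fun i j : I => H i j) = 1 := by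
    ext i j
    rw [Matrix.mul_apply, Matrix.one_apply]
    simp only [Matrix.of_apply, ← Subtype.coe_inj]
    rw [Finset.sum_coe_sort I fun n => A i n * H n j]
    exact h i i.2 j j.2
  intro m hm m' hm'
  have hcomm := mul_eq_one_comm.1 h1
  have h2 := congrFun₂ hcomm ⟨m, hm⟩ ⟨m', hm'⟩
  rw [Matrix.mul_apply, Matrix.one_apply] at h2
  simp only [Matrix.of_apply, ← Subtype.coe_inj] at h2
  rwa [Finset.sum_coe_sort I fun n => H m n * A n m'] at h2

/-! ### Matrices with exponentially decaying entries -/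

lemma summable_exp_neg_mul_abs {c : ℝ} (hc : 0 < c) :
    Summable fun k : ℤ => Real.exp (-c * |(k : ℝ)|) := by
  have h : Summable fun k : ℕ => Real.exp (-c * |((k : ℤ) : ℝ)|) := by
    have h0 : Real.exp (-c) < 1 := by simpa using hc
    refine (summable_geometric_of_lt_one (Real.exp_pos _).le h0).congr fun k => ?_
    rw [← Real.exp_nat_mul]
    congr 1
    simp [mul_comm]
  refine Summable.of_nat_of_neg h (h.congr fun k => ?_)
  simp

/-- The sum `∑ exp (-c |k|)` over the integers. -/
def expSum (c : ℝ) : ℝ := ∑' k : ℤ, Real.exp (-c * |(k : ℝ)|)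

lemma expSum_nonneg (c : ℝ) : 0 ≤ expSum c := tsum_nonneg fun _ => (Real.exp_pos _).le

lemma sum_exp_le_expSum {c : ℝ} (hc : 0 < c) (I : Finset ℤ) (m : ℤ) :
    ∑ n ∈ I, Real.exp (-c * |(m : ℝ) - n|) ≤ expSum c := by
  have h := (Equiv.subLeft m).summable_iff.2 (summable_exp_neg_mul_abs hc)
  have h2 := (Equiv.subLeft m).tsum_eq fun k : ℤ => Real.exp (-c * |(k : ℝ)|)
  rw [expSum, ← h2]
  have h3 := h.sum_le_tsum I fun _ _ => (Real.exp_pos _).le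
  simpa using h3

lemma norm_sq_sum_mul_le {ι : Type*} (J : Finset ι) (v x : ι → ℂ) :
    ‖∑ n ∈ J, v n * x n‖ ^ 2 ≤ (∑ n ∈ J, ‖v n‖) * ∑ n ∈ J, ‖v n‖ * ‖x n‖ ^ 2 := by
  have h1 : ‖∑ n ∈ J, v n * x n‖ ≤ ∑ n ∈ J, ‖v n‖ * ‖x n‖ :=
    (norm_sum_le _ _).trans_eq (Finset.sum_congr rfl fun _ _ => norm_mul _ _)
  refine (pow_le_pow_left₀ (norm_nonneg _) h1 2).trans ?_
  refine Finset.sum_sq_le_sum_mul_sum_of_sq_le_mul J (fun _ _ => norm_nonneg _)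
    (fun _ _ => by positivity) fun n _ => ?_
  exact le_of_eq (by ring)

/-- Schur's test for matrices with exponentially decaying entries. -/
lemma schur_exp {c C : ℝ} (hc : 0 < c) (hC : 0 ≤ C) (I J : Finset ℤ) (A : ℤ → ℤ → ℂ)
    (hA : ∀ m ∈ I, ∀ n ∈ J, ‖A m n‖ ≤ C * Real.exp (-c * |(m : ℝ) - n|)) (x : ℤ → ℂ) :
    ∑ m ∈ I, ‖∑ n ∈ J, A m n * x n‖ ^ 2 ≤ (C * expSum c) ^ 2 * ∑ n ∈ J, ‖x n‖ ^ 2 := by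
  have hrow : ∀ m ∈ I, ∑ n ∈ J, ‖A m n‖ ≤ C * expSum c := fun m hm => by
    refine (Finset.sum_le_sum (hA m hm)).trans ?_
    rw [← Finset.mul_sum]
    exact mul_le_mul_of_nonneg_left (sum_exp_le_expSum hc J m) hC
  have hcol : ∀ n ∈ J, ∑ m ∈ I, ‖A m n‖ ≤ C * expSum c := fun n hn => by
    refine (Finset.sum_le_sum fun m hm => hA m hm n hn).trans ?_
    rw [← Finset.mul_sum]
    refine mul_le_mul_of_nonneg_left ?_ hC
    simpa only [abs_sub_comm] using sum_exp_le_expSum hc I n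
  have hK : 0 ≤ C * expSum c := mul_nonneg hC (expSum_nonneg c)
  calc ∑ m ∈ I, ‖∑ n ∈ J, A m n * x n‖ ^ 2
      ≤ ∑ m ∈ I, (C * expSum c) * ∑ n ∈ J, ‖A m n‖ * ‖x n‖ ^ 2 :=
        Finset.sum_le_sum fun m hm => (norm_sq_sum_mul_le J _ _).trans
          (mul_le_mul_of_nonneg_right (hrow m hm)
            (Finset.sum_nonneg fun _ _ => by positivity))
    _ = (C * expSum c) * ∑ n ∈ J, (∑ m ∈ I, ‖A m n‖) * ‖x n‖ ^ 2 := by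
        rw [← Finset.mul_sum, Finset.sum_comm]
        simp only [Finset.sum_mul]
    _ ≤ (C * expSum c) * ∑ n ∈ J, (C * expSum c) * ‖x n‖ ^ 2 :=
        mul_le_mul_of_nonneg_left (Finset.sum_le_sum fun n hn =>
          mul_le_mul_of_nonneg_right (hcol n hn) (by positivity)) hK
    _ = _ := by rw [← Finset.mul_sum]; ring

/-! ### Balanced nodes and uniform bounds for the inverse matrices -/

/-- The counting discrepancy between the integers of `I` and the nodes `u k`, `k ∈ I`. -/
def discrepancy (u : ℤ → ℝ) (I : Finset ℤ) (x : ℝ) : ℝ :=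
  ∑ k ∈ I, (max x (k : ℝ) - max x (u k))

/-- The nodes `u k` are close to the integers, separated, and balanced over the index set `I`. -/
structure IsBalanced (u : ℤ → ℝ) (I : Finset ℤ) (L ρ K κ : ℝ) : Prop where
  near : ∀ k, |u k - k| ≤ L
  sep : ∀ m k : ℤ, ρ * |(m : ℝ) - k| ≤ |u m - u k|
  bal : ∀ x y : ℝ, |discrepancy u I x - discrepancy u I y| ≤ K + κ * |x - y|

lemma exp_add_exp_eq (σ x y : ℝ) : Real.exp (σ * x) + Real.exp (σ * y) =
    Real.exp (σ * max x y) * (1 + Real.exp (-σ * |x - y|)) := by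
  rw [mul_add, mul_one, ← Real.exp_add]
  rcases le_total x y with h | h
  · rw [max_eq_right h, abs_of_nonpos (by linarith), add_comm]
    ring_nf
  · rw [max_eq_left h, abs_of_nonneg (by linarith)]
    ring_nf

lemma abs_exp_sub_exp_eq {σ : ℝ} (hσ : 0 ≤ σ) (x y : ℝ) :
    |Real.exp (σ * x) - Real.exp (σ * y)| =
      Real.exp (σ * max x y) * (1 - Real.exp (-σ * |x - y|)) := by
  rw [mul_sub, mul_one, ← Real.exp_add]
  rcases le_total x y with h | h
  · rw [max_eq_right h, abs_of_nonpos (a := x - y) (by linarith), abs_of_nonpos]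
    · ring_nf
    · have := mul_le_mul_of_nonneg_left h hσ
      simpa using this
  · rw [max_eq_left h, abs_of_nonneg (a := x - y) (by linarith), abs_of_nonneg]
    · ring_nf
    · have := mul_le_mul_of_nonneg_left h hσ
      simpa using this

lemma norm_exp_mul_ofReal (p : ℂ) (x : ℝ) : ‖Complex.exp (p * x)‖ = Real.exp (p.re * x) := by
  rw [Complex.norm_exp]
  simp

lemma prod_norm_add_le (p : ℂ) (J : Finset ℤ) (x : ℝ) (y : ℤ → ℝ) :
    ∏ k ∈ J, ‖Complex.exp (p * x) + Complex.exp (p * y k)‖ ≤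
      Real.exp (p.re * ∑ k ∈ J, max x (y k) + ∑ k ∈ J, Real.exp (-p.re * |x - y k|)) := by
  rw [Finset.mul_sum, ← Finset.sum_add_distrib, Real.exp_sum]
  refine Finset.prod_le_prod (fun _ _ => norm_nonneg _) fun k _ => ?_
  refine (norm_add_le _ _).trans ?_
  rw [norm_exp_mul_ofReal, norm_exp_mul_ofReal, exp_add_exp_eq, Real.exp_add]
  refine mul_le_mul_of_nonneg_left ?_ (Real.exp_pos _).le
  rw [add_comm]
  exact Real.add_one_le_exp _

lemma exp_neg_le_one_sub {q t : ℝ} (ht : 0 ≤ t) (htq : t ≤ q) (hq : q < 1) :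
    Real.exp (-((1 - q)⁻¹ * t)) ≤ 1 - t := by
  have h0 : 0 < 1 - t := by linarith
  have h1 := Real.one_sub_inv_le_log_of_pos h0
  rw [← Real.le_log_iff_exp_le h0]
  refine le_trans ?_ h1
  have h2 : 1 - (1 - t)⁻¹ = -((1 - t)⁻¹ * t) := by
    field_simp
    ring
  rw [h2, neg_le_neg_iff]
  refine mul_le_mul_of_nonneg_right ?_ ht
  exact inv_anti₀ (by linarith) (by linarith)

lemma le_prod_norm_sub (p : ℂ) (hp : 0 ≤ p.re) (J : Finset ℤ) (x : ℝ) (y : ℤ → ℝ) {q : ℝ}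
    (hq : q < 1) (hJ : ∀ k ∈ J, Real.exp (-p.re * |x - y k|) ≤ q) :
    Real.exp (p.re * ∑ k ∈ J, max x (y k) - (1 - q)⁻¹ * ∑ k ∈ J, Real.exp (-p.re * |x - y k|)) ≤
      ∏ k ∈ J, ‖Complex.exp (p * x) - Complex.exp (p * y k)‖ := by
  rw [Finset.mul_sum, Finset.mul_sum, ← Finset.sum_sub_distrib, Real.exp_sum]
  refine Finset.prod_le_prod (fun _ _ => (Real.exp_pos _).le) fun k hk => ?_
  refine le_trans ?_ (abs_norm_sub_norm_le _ _)
  rw [norm_exp_mul_ofReal, norm_exp_mul_ofReal, abs_exp_sub_exp_eq hp, sub_eq_add_neg,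
    Real.exp_add]
  exact mul_le_mul_of_nonneg_left (exp_neg_le_one_sub (Real.exp_pos _).le (hJ k hk) hq)
    (Real.exp_pos _).le

lemma sum_exp_near_le {σ L : ℝ} (hσ : 0 < σ) (J : Finset ℤ) (x y : ℤ → ℝ) (m : ℤ)
    (h : ∀ k ∈ J, |(m : ℝ) - k| - L ≤ |x m - y k|) :
    ∑ k ∈ J, Real.exp (-σ * |x m - y k|) ≤ Real.exp (σ * L) * expSum σ := by
  refine le_trans ?_ (mul_le_mul_of_nonneg_left (sum_exp_le_expSum hσ J m) (Real.exp_pos _).le)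
  rw [Finset.mul_sum]
  refine Finset.sum_le_sum fun k hk => ?_
  rw [← Real.exp_add, Real.exp_le_exp]
  nlinarith [h k hk]

/-- The product of differences is bounded below for separated nodes. -/
lemma le_prod_norm_sub_of_sep (p : ℂ) (hp : 0 < p.re) {ρ : ℝ} (hρ : 0 < ρ) (x : ℤ → ℝ)
    (hx : ∀ m k : ℤ, ρ * |(m : ℝ) - k| ≤ |x m - x k|) (I : Finset ℤ) (m : ℤ) :
    Real.exp (p.re * ∑ k ∈ I.erase m, max (x m) (x k) -
        (1 - Real.exp (-(p.re * ρ)))⁻¹ * expSum (p.re * ρ)) ≤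
      ∏ k ∈ I.erase m, ‖Complex.exp (p * x m) - Complex.exp (p * x k)‖ := by
  have hpρ : 0 < p.re * ρ := mul_pos hp hρ
  have hq : Real.exp (-(p.re * ρ)) < 1 := by simpa using hpρ
  refine le_trans ?_ (le_prod_norm_sub p hp.le (I.erase m) (x m) x hq fun k hk => ?_)
  · rw [Real.exp_le_exp]
    refine sub_le_sub_left (mul_le_mul_of_nonneg_left ?_ (inv_nonneg.2 (by linarith))) _
    refine le_trans (Finset.sum_le_sum fun k _ => ?_) (sum_exp_le_expSum hpρ (I.erase m) m)
    rw [Real.exp_le_exp]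
    nlinarith [hx m k]
  · rw [Real.exp_le_exp]
    have h1 : (1 : ℝ) ≤ |(m : ℝ) - k| := by
      have : m - k ≠ 0 := sub_ne_zero.2 (Finset.ne_of_mem_erase hk).symm
      exact_mod_cast Int.one_le_abs this
    have h2 : ρ ≤ |x m - x k| := by nlinarith [hx m k]
    nlinarith

lemma IsBalanced.near_abs {u : ℤ → ℝ} {I : Finset ℤ} {L ρ K κ : ℝ}
    (h : IsBalanced u I L ρ K κ) (m k : ℤ) : |(m : ℝ) - k| - L ≤ |u m - k| := by
  have h1 := h.near m
  have h2 : |(m : ℝ) - k| ≤ |u m - k| + |u m - m| := by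
    have := abs_sub_abs_le_abs_sub ((m : ℝ) - k) (m - u m)
    have h3 : (m : ℝ) - k - (m - u m) = u m - k := by ring
    rw [h3, abs_sub_comm (m : ℝ) (u m)] at this
    linarith
  linarith

lemma IsBalanced.ne {u : ℤ → ℝ} {I : Finset ℤ} {L ρ K κ : ℝ}
    (h : IsBalanced u I L ρ K κ) (hρ : 0 < ρ) {m k : ℤ} (hmk : m ≠ k) : u m ≠ u k := by
  intro he
  have h1 := h.sep m k
  rw [he, sub_self, abs_zero] at h1
  have h2 : 0 < |(m : ℝ) - k| := abs_pos.2 (sub_ne_zero.2 (by exact_mod_cast hmk))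
  nlinarith

lemma exp_mul_injective {p : ℂ} (hp : 0 < p.re) {x y : ℝ}
    (h : Complex.exp (p * x) = Complex.exp (p * y)) : x = y := by
  have h1 := congrArg norm h
  rw [norm_exp_mul_ofReal, norm_exp_mul_ofReal, Real.exp_eq_exp] at h1
  exact mul_left_cancel₀ hp.ne' h1

lemma exp_add_exp_ne_zero {p : ℂ} (hp : 0 < p.re) (x y : ℝ) :
    Complex.exp (p * x) + Complex.exp (p * y) ≠ 0 := by
  intro h
  have h1 := congrArg norm (eq_neg_of_add_eq_zero_left h)
  rw [norm_neg, norm_exp_mul_ofReal, norm_exp_mul_ofReal, Real.exp_eq_exp] at h1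
  rw [mul_left_cancel₀ hp.ne' h1, ← two_mul] at h
  simp at h

lemma norm_cauchyInv_le {p : ℂ} (hp : 0 < p.re) {u : ℤ → ℝ} {I : Finset ℤ} {L ρ K κ : ℝ}
    (hρ : 0 < ρ) (hρ1 : ρ ≤ 1) (h : IsBalanced u I L ρ K κ) {n m : ℤ} (hn : n ∈ I) (hm : m ∈ I) :
    ‖cauchyInv I (fun k => Complex.exp (p * u k)) (fun k => Complex.exp (p * (k : ℝ))) n m‖ ≤
      Real.exp (2 * (Real.exp (p.re * L) * expSum p.re) +
        2 * ((1 - Real.exp (-(p.re * ρ)))⁻¹ * expSum (p.re * ρ)) +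
        p.re * (K + κ * |u m - n| + min (u m) n)) := by
  set X := Real.exp (p.re * L) * expSum p.re with hX
  set Y := (1 - Real.exp (-(p.re * ρ)))⁻¹ * expSum (p.re * ρ) with hY
  have h1 : ∏ k ∈ I, ‖Complex.exp (p * u m) + Complex.exp (p * (k : ℝ))‖ ≤
      Real.exp (p.re * ∑ k ∈ I, max (u m) k + X) := by
    refine (prod_norm_add_le p I (u m) fun k => (k : ℝ)).trans ?_
    rw [Real.exp_le_exp]
    exact add_le_add_right (sum_exp_near_le hp I u (fun k => (k : ℝ)) m fun k _ => h.near_abs m k) _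
  have h2 : ∏ k ∈ I.erase m, ‖-Complex.exp (p * (n : ℝ)) - Complex.exp (p * u k)‖ ≤
      Real.exp (p.re * ∑ k ∈ I.erase m, max (n : ℝ) (u k) + X) := by
    have he : ∀ k, ‖-Complex.exp (p * (n : ℝ)) - Complex.exp (p * u k)‖ =
        ‖Complex.exp (p * (n : ℝ)) + Complex.exp (p * u k)‖ := fun k => by
      rw [← norm_neg]; ring_nf
    simp only [he]
    refine (prod_norm_add_le p (I.erase m) n u).trans ?_
    rw [Real.exp_le_exp]
    refine add_le_add_right (sum_exp_near_le hp _ (fun k => (k : ℝ)) u n fun k _ => ?_) _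
    rw [abs_sub_comm, abs_sub_comm (n : ℝ) (u k)]
    exact h.near_abs k n
  have h3 := le_prod_norm_sub_of_sep p hp hρ u h.sep I m
  have h4 := le_prod_norm_sub_of_sep p hp hρ (fun k => (k : ℝ))
    (fun m k => mul_le_of_le_one_left (abs_nonneg _) hρ1) I n
  rw [← hY] at h3 h4
  have he : ∀ k : ℤ, ‖Complex.exp (p * (n : ℝ)) - Complex.exp (p * (k : ℝ))‖ =
      ‖Complex.exp (p * (k : ℝ)) - Complex.exp (p * (n : ℝ))‖ := fun k => norm_sub_rev _ _
  simp only [he] at h4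
  rw [cauchyInv, norm_div, norm_mul, norm_mul, norm_prod, norm_prod, norm_prod, norm_prod]
  refine (div_le_div₀ (by positivity) (mul_le_mul h1 h2 (by positivity) (by positivity))
    (by positivity) (mul_le_mul h3 h4 (by positivity) (by positivity))).trans ?_
  rw [← Real.exp_add, ← Real.exp_add, ← Real.exp_sub, Real.exp_le_exp]
  have hb := (abs_le.1 (h.bal (u m) n)).2
  have e1 := Finset.sum_erase_eq_sub (f := fun k => max (n : ℝ) (u k)) hm
  have e2 := Finset.sum_erase_eq_sub (f := fun k => max (u m) (u k)) hm
  have e3 := Finset.sum_erase_eq_sub (f := fun k : ℤ => max (n : ℝ) k) hn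
  simp only [max_self] at e1 e2 e3
  rw [e1, e2, e3]
  simp only [discrepancy, Finset.sum_sub_distrib] at hb
  have hmm := min_add_max (u m) (n : ℝ)
  rw [max_comm (u m) (n : ℝ)] at hmm
  nlinarith [mul_le_mul_of_nonneg_left hb hp.le]

/-! ### The generator -/

/-- The function `x ↦ 1 / (exp (a x) + exp (-b x))`. -/
def gen (a b : ℂ) (x : ℝ) : ℂ := 1 / (Complex.exp (a * x) + Complex.exp (-b * x))

lemma gen_denom_ne_zero {a b : ℂ} (ha : 0 < a.re) (hb : 0 < b.re) (x : ℝ) :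
    Complex.exp (a * x) + Complex.exp (-b * x) ≠ 0 := by
  have hp : 0 < (a + b).re := by simpa using add_pos ha hb
  have h := exp_add_exp_ne_zero hp x 0
  have he : Complex.exp (a * x) + Complex.exp (-b * x) =
      Complex.exp (-b * x) * (Complex.exp ((a + b) * x) + Complex.exp ((a + b) * (0 : ℝ))) := by
    rw [mul_add, ← Complex.exp_add, ← Complex.exp_add]
    simp only [ofReal_zero, mul_zero, add_zero]
    ring_nf
  rw [he]
  exact mul_ne_zero (Complex.exp_ne_zero _) h

lemma gen_sub (a b : ℂ) (x y : ℝ) :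
    gen a b (x - y) = Complex.exp (a * y) * Complex.exp (b * x) *
      (1 / (Complex.exp ((a + b) * x) + Complex.exp ((a + b) * y))) := by
  have he : Complex.exp ((a + b) * x) + Complex.exp ((a + b) * y) =
      Complex.exp (a * y) * Complex.exp (b * x) *
        (Complex.exp (a * (x - y : ℝ)) + Complex.exp (-b * (x - y : ℝ))) := by
    rw [mul_add, ← Complex.exp_add, ← Complex.exp_add, ← Complex.exp_add]
    push_cast
    ring_nf
  rw [he, one_div, mul_inv, ← mul_assoc, mul_inv_cancel₀, one_mul, gen, one_div]
  exact mul_ne_zero (Complex.exp_ne_zero _) (Complex.exp_ne_zero _)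

lemma continuous_gen {a b : ℂ} (ha : 0 < a.re) (hb : 0 < b.re) : Continuous (gen a b) := by
  unfold gen
  exact continuous_const.div (by fun_prop) (gen_denom_ne_zero ha hb)

lemma exists_norm_gen_le {a b : ℂ} (ha : 0 < a.re) (hb : 0 < b.re) :
    ∃ C, 0 ≤ C ∧ ∀ x, ‖gen a b x‖ ≤ C * Real.exp (-(min a.re b.re) * |x|) := by
  set c := min a.re b.re with hc
  have hc0 : 0 < c := lt_min ha hb
  have hca : c ≤ a.re := min_le_left _ _
  have hcb : c ≤ b.re := min_le_right _ _
  obtain ⟨M, hM⟩ := (isCompact_Icc (a := (-1 : ℝ)) (b := 1)).exists_bound_of_continuousOn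
    (continuous_gen ha hb).continuousOn
  have hq : Real.exp (-(a.re + b.re)) < 1 := by
    rw [Real.exp_lt_one_iff]
    linarith
  set D := (1 - Real.exp (-(a.re + b.re)))⁻¹ with hD
  have hDpos : 0 < D := inv_pos.2 (by linarith)
  have hM0 : 0 ≤ M := (norm_nonneg _).trans (hM 0 (by simp))
  refine ⟨M * Real.exp c + D, by positivity, fun x => ?_⟩
  by_cases hx : |x| ≤ 1
  · have h1 : Real.exp c * Real.exp (-c * |x|) ≥ 1 := by
      rw [← Real.exp_add, ge_iff_le, Real.one_le_exp_iff]
      nlinarith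
    have h2 := hM x (abs_le.1 hx)
    have h3 : 0 ≤ D * Real.exp (-c * |x|) := by positivity
    nlinarith
  · have hx1 : 1 < |x| := not_le.1 hx
    have h0 : 0 ≤ M * Real.exp c * Real.exp (-c * |x|) := by positivity
    suffices h : ‖gen a b x‖ ≤ D * Real.exp (-c * |x|) by linarith
    have hmax : Real.exp (c * |x|) * (1 - Real.exp (-(a.re + b.re))) ≤
        ‖Complex.exp (a * x) + Complex.exp (-b * x)‖ := by
      have hn : |Real.exp (a.re * x) - Real.exp (-b.re * x)| ≤
          ‖Complex.exp (a * x) + Complex.exp (-b * x)‖ := by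
        have := abs_norm_sub_norm_le (Complex.exp (a * x)) (-Complex.exp (-b * x))
        rwa [norm_neg, sub_neg_eq_add, norm_exp_mul_ofReal, norm_exp_mul_ofReal,
          Complex.neg_re] at this
      refine le_trans ?_ hn
      rcases le_total 0 x with h | h
      · rw [abs_of_nonneg h] at hx1 ⊢
        refine le_trans ?_ (le_abs_self _)
        have e : Real.exp (a.re * x) - Real.exp (-b.re * x) =
            Real.exp (a.re * x) * (1 - Real.exp (-(a.re + b.re) * x)) := by
          rw [mul_sub, mul_one, ← Real.exp_add]; ring_nf
        rw [e]
        refine mul_le_mul (Real.exp_le_exp.2 (by nlinarith)) ?_ (by linarith) (by positivity)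
        exact sub_le_sub_left (Real.exp_le_exp.2 (by nlinarith)) _
      · rw [abs_of_nonpos h] at hx1 ⊢
        refine le_trans ?_ (neg_le_abs _)
        have e : -(Real.exp (a.re * x) - Real.exp (-b.re * x)) =
            Real.exp (-b.re * x) * (1 - Real.exp ((a.re + b.re) * x)) := by
          rw [mul_sub, mul_one, ← Real.exp_add]; ring_nf
        rw [e]
        refine mul_le_mul (Real.exp_le_exp.2 (by nlinarith)) ?_ (by linarith) (by positivity)
        exact sub_le_sub_left (Real.exp_le_exp.2 (by nlinarith)) _
    rw [gen, norm_div, norm_one, one_div, neg_mul c, Real.exp_neg, mul_comm D, hD, ← mul_inv]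
    exact inv_anti₀ (mul_pos (Real.exp_pos _) (by linarith)) hmax

/-- The finite sections of `(gen a b (u m - n))` over balanced index sets are invertible, with
exponentially decaying inverses, uniformly in the index set. -/
lemma exists_finite_inverse {a b : ℂ} (ha : 0 < a.re) (hb : 0 < b.re) {L ρ K κ : ℝ}
    (hρ : 0 < ρ) (hρ1 : ρ ≤ 1) (hκ : (a.re + b.re) * κ < min a.re b.re) :
    ∃ C c, 0 ≤ C ∧ 0 < c ∧ ∀ u I, IsBalanced u I L ρ K κ → ∃ H : ℤ → ℤ → ℂ,
      (∀ n ∈ I, ∀ m ∈ I, ‖H n m‖ ≤ C * Real.exp (-c * |(n : ℝ) - m|)) ∧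
      (∀ m ∈ I, ∀ m' ∈ I, ∑ n ∈ I, gen a b (u m - n) * H n m' = if m = m' then 1 else 0) ∧
      (∀ n ∈ I, ∀ n' ∈ I, ∑ m ∈ I, H n m * gen a b (u m - n') = if n = n' then 1 else 0) := by
  set c := min a.re b.re - (a.re + b.re) * κ with hc
  have hc0 : 0 < c := sub_pos.2 hκ
  have hp : 0 < (a + b).re := by simpa using add_pos ha hb
  set X := 2 * (Real.exp ((a + b).re * L) * expSum (a + b).re) +
        2 * ((1 - Real.exp (-((a + b).re * ρ)))⁻¹ * expSum ((a + b).re * ρ)) with hX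
  refine ⟨Real.exp (X + (a + b).re * K + c * L), c, by positivity, hc0, fun u I hu => ?_⟩
  set H : ℤ → ℤ → ℂ := fun n m => Complex.exp (-a * (n : ℝ)) * Complex.exp (-b * u m) *
    cauchyInv I (fun k => Complex.exp ((a + b) * u k))
      (fun k => Complex.exp ((a + b) * (k : ℝ))) n m with hH
  have hright : ∀ m ∈ I, ∀ m' ∈ I,
      ∑ n ∈ I, gen a b (u m - n) * H n m' = if m = m' then 1 else 0 := by
    intro m hm m' hm'
    have h1 := sum_cauchy_mul_cauchyInv I (fun k => Complex.exp ((a + b) * u k))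
      (fun k => Complex.exp ((a + b) * (k : ℝ)))
      (fun x _ y _ h => by_contra fun hxy => hu.ne hρ hxy (exp_mul_injective hp h))
      (fun x _ y _ h => by exact_mod_cast exp_mul_injective hp h)
      (fun m _ n _ => exp_add_exp_ne_zero hp _ _) hm hm'
    have h2 : ∑ n ∈ I, gen a b (u m - n) * H n m' =
        Complex.exp (b * u m) * Complex.exp (-b * u m') * if m = m' then 1 else 0 := by
      rw [← h1, Finset.mul_sum]
      refine Finset.sum_congr rfl fun n _ => ?_
      have h3 : Complex.exp (a * (n : ℝ)) * Complex.exp (-a * (n : ℝ)) = 1 := by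
        rw [← Complex.exp_add]; simp
      rw [gen_sub, hH]
      linear_combination (Complex.exp (b * u m) * Complex.exp (-b * u m') *
        (1 / (Complex.exp ((a + b) * u m) + Complex.exp ((a + b) * (n : ℝ)))) *
        cauchyInv I (fun k => Complex.exp ((a + b) * u k))
          (fun k => Complex.exp ((a + b) * (k : ℝ))) n m') * h3
    rw [h2]
    split_ifs with h
    · rw [h, ← Complex.exp_add]; simp
    · simp
  refine ⟨H, fun n hn m hm => ?_, hright,
    sum_mul_eq_ite_comm I (fun m n => gen a b (u m - n)) H hright⟩
  have h1 := norm_cauchyInv_le hp hρ hρ1 hu hn hm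
  rw [hH, norm_mul, norm_mul, norm_exp_mul_ofReal, norm_exp_mul_ofReal, ← Real.exp_add]
  refine (mul_le_mul_of_nonneg_left h1 (Real.exp_pos _).le).trans ?_
  rw [← Real.exp_add, ← Real.exp_add, Real.exp_le_exp, ← hX]
  have h2 : -a.re * n + -b.re * u m + (a + b).re * min (u m) n ≤
      -(min a.re b.re) * |u m - n| := by
    rw [Complex.add_re]
    rcases le_total (u m) n with h | h
    · rw [min_eq_left h, abs_of_nonpos (by linarith)]
      nlinarith [min_le_left a.re b.re]
    · rw [min_eq_right h, abs_of_nonneg (by linarith)]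
      nlinarith [min_le_right a.re b.re]
  have h3 := mul_le_mul_of_nonneg_left (hu.near_abs m n) hc0.le
  rw [abs_sub_comm (n : ℝ) m]
  have h4 : c * |u m - n| = min a.re b.re * |u m - n| - (a + b).re * (κ * |u m - n|) := by
    rw [hc, Complex.add_re]; ring
  simp only [Complex.neg_re] at *
  nlinarith

/-! ### Sampling and interpolation at balanced nodes -/

lemma exists_norm_gen_sub_le {a b : ℂ} (ha : 0 < a.re) (hb : 0 < b.re) (L : ℝ) :
    ∃ C, 0 ≤ C ∧ ∀ (x : ℝ) (m n : ℤ), |x - m| ≤ L →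
      ‖gen a b (x - n)‖ ≤ C * Real.exp (-(min a.re b.re) * |(m : ℝ) - n|) := by
  obtain ⟨C, hC, h⟩ := exists_norm_gen_le ha hb
  have hc : 0 < min a.re b.re := lt_min ha hb
  refine ⟨C * Real.exp (min a.re b.re * L), by positivity, fun x m n hx => (h _).trans ?_⟩
  rw [mul_assoc, ← Real.exp_add]
  refine mul_le_mul_of_nonneg_left (Real.exp_le_exp.2 ?_) hC
  have h1 : |(m : ℝ) - n| ≤ |x - n| + |x - m| := by
    have := abs_sub_le (m : ℝ) x n
    rw [abs_sub_comm (m : ℝ) x] at this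
    linarith
  nlinarith

lemma summable_norm_gen_sub {a b : ℂ} (ha : 0 < a.re) (hb : 0 < b.re) (x : ℝ) :
    Summable fun n : ℤ => ‖gen a b (x - n)‖ := by
  obtain ⟨C, -, h⟩ := exists_norm_gen_sub_le ha hb |x|
  have hs := (summable_exp_neg_mul_abs (lt_min ha hb)).mul_left C
  refine Summable.of_nonneg_of_le (fun _ => norm_nonneg _) (fun n => ?_) hs
  simpa using h x 0 n (by simp)

lemma summable_mul_gen_sub {a b : ℂ} (ha : 0 < a.re) (hb : 0 < b.re) (x : ℝ) {c : ℤ → ℂ} {M : ℝ}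
    (hM : ∀ n, ‖c n‖ ≤ M) : Summable fun n : ℤ => c n * gen a b (x - n) := by
  refine Summable.of_norm_bounded ((summable_norm_gen_sub ha hb x).mul_left M) fun n => ?_
  rw [norm_mul]
  exact mul_le_mul_of_nonneg_right (hM n) (norm_nonneg _)

lemma norm_le_sqrt_of_sum_sq_le {c : ℤ → ℂ} {T : ℝ} (h : ∀ J : Finset ℤ, ∑ n ∈ J, ‖c n‖ ^ 2 ≤ T)
    (n : ℤ) : ‖c n‖ ≤ √T :=
  Real.le_sqrt_of_sq_le (by simpa using h {n})

/-- Upper bound for the samples in terms of the coefficients. -/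
lemma exists_sampling_upper {a b : ℂ} (ha : 0 < a.re) (hb : 0 < b.re) (L : ℝ) :
    ∃ C, 0 ≤ C ∧ ∀ u : ℤ → ℝ, (∀ k, |u k - k| ≤ L) → ∀ c f : ℤ → ℂ,
      (Summable fun n => ‖c n‖ ^ 2) →
      (∀ m, HasSum (fun n : ℤ => c n * gen a b (u m - n)) (f m)) →
      (Summable fun m => ‖f m‖ ^ 2) ∧ ∑' m, ‖f m‖ ^ 2 ≤ C * ∑' n, ‖c n‖ ^ 2 := by
  obtain ⟨C, hC, h⟩ := exists_norm_gen_sub_le ha hb L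
  have hc : 0 < min a.re b.re := lt_min ha hb
  refine ⟨(C * expSum (min a.re b.re)) ^ 2, by positivity, fun u hu c f hcs hf => ?_⟩
  have key : ∀ I : Finset ℤ, ∑ m ∈ I, ‖f m‖ ^ 2 ≤
      (C * expSum (min a.re b.re)) ^ 2 * ∑' n, ‖c n‖ ^ 2 := by
    intro I
    have ht : Tendsto (fun J : Finset ℤ => ∑ m ∈ I, ‖∑ n ∈ J, c n * gen a b (u m - n)‖ ^ 2) atTop
        (nhds (∑ m ∈ I, ‖f m‖ ^ 2)) :=
      tendsto_finsetSum I fun m _ => ((hf m).norm.pow 2)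
    refine le_of_tendsto' ht fun J => ?_
    have hs := schur_exp hc hC I J (fun m n => gen a b (u m - n))
      (fun m _ n _ => h (u m) m n (hu m)) c
    simp only [mul_comm (gen a b _)] at hs
    exact hs.trans (mul_le_mul_of_nonneg_left (hcs.sum_le_tsum J fun _ _ => by positivity)
      (by positivity))
  have hsum := summable_of_sum_le (fun m => by positivity) key
  exact ⟨hsum, hsum.tsum_le_of_sum_le key⟩

/-- The nodes `u` are balanced along an exhausting sequence of finite index sets. -/
def IsBalancedAlong (u : ℤ → ℝ) (L ρ K κ : ℝ) : Prop :=
  ∃ I : ℕ → Finset ℤ, Tendsto I atTop atTop ∧ ∀ N, IsBalanced u (I N) L ρ K κ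

/-- Lower bound for the samples in terms of the coefficients. -/
lemma exists_sampling_lower {a b : ℂ} (ha : 0 < a.re) (hb : 0 < b.re) {L ρ K κ : ℝ}
    (hρ : 0 < ρ) (hρ1 : ρ ≤ 1) (hκ : (a.re + b.re) * κ < min a.re b.re) :
    ∃ C, 0 < C ∧ ∀ u : ℤ → ℝ, IsBalancedAlong u L ρ K κ → ∀ c f : ℤ → ℂ,
      (Summable fun n => ‖c n‖ ^ 2) →
      (∀ m, HasSum (fun n : ℤ => c n * gen a b (u m - n)) (f m)) →
      ∑' n, ‖c n‖ ^ 2 ≤ C * ∑' m, ‖f m‖ ^ 2 := by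
  obtain ⟨D, d, hD, hd, hinv⟩ := exists_finite_inverse ha hb hρ hρ1 hκ (L := L) (K := K)
  obtain ⟨E, hE, hup⟩ := exists_sampling_upper ha hb L
  set Q := (D * expSum d) ^ 2 with hQ
  have hQ0 : 0 ≤ Q := by positivity
  refine ⟨2 * Q + 1, by positivity, ?_⟩
  rintro u ⟨I, hI, hbal⟩ c f hc hf
  have hfs := (hup u (hbal 0).near c f hc hf).1
  set T := ∑' n, ‖c n‖ ^ 2 with hT
  have hcT : Tendsto (fun N => ∑ n ∈ I N, ‖c n‖ ^ 2) atTop (nhds T) := hc.hasSum.comp hI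
  have key : ∀ N, ∑ n ∈ I N, ‖c n‖ ^ 2 ≤
      2 * Q * ∑' m, ‖f m‖ ^ 2 + 2 * Q * (E * (T - ∑ n ∈ I N, ‖c n‖ ^ 2)) := by
    intro N
    obtain ⟨H, hH, -, hleft⟩ := hinv u (I N) (hbal N)
    set fN : ℤ → ℂ := fun m => ∑ n ∈ I N, c n * gen a b (u m - n) with hfN
    have hrec : ∀ n ∈ I N, ∑ m ∈ I N, H n m * fN m = c n := by
      intro n hn
      simp only [hfN, Finset.mul_sum]
      rw [Finset.sum_comm]
      have h1 : ∀ k ∈ I N, ∑ m ∈ I N, H n m * (c k * gen a b (u m - k)) =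
          if n = k then c k else 0 := by
        intro k hk
        rw [← mul_boole, ← hleft n hn k hk, Finset.mul_sum]
        exact Finset.sum_congr rfl fun m _ => by ring
      rw [Finset.sum_congr rfl h1]
      simp [hn]
    have h1 : ∑ n ∈ I N, ‖c n‖ ^ 2 ≤ Q * ∑ m ∈ I N, ‖fN m‖ ^ 2 := by
      refine le_trans (Finset.sum_le_sum fun n hn => ?_) (schur_exp hd hD (I N) (I N) H hH fN)
      rw [hrec n hn]
    have hsq : ∀ m, ‖fN m‖ ^ 2 ≤ 2 * ‖f m‖ ^ 2 + 2 * ‖f m - fN m‖ ^ 2 := fun m => by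
      have h2 : ‖fN m‖ ≤ ‖f m‖ + ‖f m - fN m‖ := by
        have := norm_sub_le (f m) (f m - fN m)
        rwa [sub_sub_cancel] at this
      nlinarith [sq_nonneg (‖f m‖ - ‖f m - fN m‖), norm_nonneg (fN m)]
    set c' : ℤ → ℂ := fun n => c n - if n ∈ I N then c n else 0 with hc'
    have hf' : ∀ m, HasSum (fun n : ℤ => c' n * gen a b (u m - n)) (f m - fN m) := by
      intro m
      have h3 : HasSum (fun n : ℤ => (if n ∈ I N then c n else 0) * gen a b (u m - n))
          (∑ n ∈ I N, (if n ∈ I N then c n else 0) * gen a b (u m - n)) :=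
        hasSum_sum_of_ne_finset_zero fun n hn => by simp [hn]
      have h4 : ∑ n ∈ I N, (if n ∈ I N then c n else 0) * gen a b (u m - n) = fN m :=
        Finset.sum_congr rfl fun n hn => by simp [hn]
      rw [h4] at h3
      simpa only [hc', sub_mul] using (hf m).sub h3
    have hcs : HasSum (fun n => ‖c' n‖ ^ 2) (T - ∑ n ∈ I N, ‖c n‖ ^ 2) := by
      have h3 : HasSum (fun n : ℤ => if n ∈ I N then ‖c n‖ ^ 2 else 0)
          (∑ n ∈ I N, if n ∈ I N then ‖c n‖ ^ 2 else 0) :=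
        hasSum_sum_of_ne_finset_zero fun n hn => by simp [hn]
      have h4 : ∑ n ∈ I N, (if n ∈ I N then ‖c n‖ ^ 2 else 0) = ∑ n ∈ I N, ‖c n‖ ^ 2 :=
        Finset.sum_congr rfl fun n hn => by simp [hn]
      rw [h4] at h3
      refine (hc.hasSum.sub h3).congr_fun fun n => ?_
      by_cases hn : n ∈ I N <;> simp [hc', hn]
    obtain ⟨hs', hle'⟩ := hup u (hbal 0).near c' _ hcs.summable hf'
    rw [hcs.tsum_eq] at hle'
    have h5 : ∑ m ∈ I N, ‖fN m‖ ^ 2 ≤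
        2 * ∑' m, ‖f m‖ ^ 2 + 2 * (E * (T - ∑ n ∈ I N, ‖c n‖ ^ 2)) := by
      refine (Finset.sum_le_sum fun m _ => hsq m).trans ?_
      rw [Finset.sum_add_distrib, ← Finset.mul_sum, ← Finset.mul_sum]
      have h6 := hfs.sum_le_tsum (I N) fun _ _ => by positivity
      have h7 := hs'.sum_le_tsum (I N) fun _ _ => by positivity
      linarith
    nlinarith [mul_le_mul_of_nonneg_left h5 hQ0]
  have hlim : Tendsto (fun N => 2 * Q * ∑' m, ‖f m‖ ^ 2 +
      2 * Q * (E * (T - ∑ n ∈ I N, ‖c n‖ ^ 2))) atTop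
      (nhds (2 * Q * ∑' m, ‖f m‖ ^ 2 + 2 * Q * (E * (T - T)))) :=
    (((hcT.const_sub T).const_mul E).const_mul (2 * Q)).const_add _
  have hfin := le_of_tendsto_of_tendsto' hcT hlim key
  have h0 : 0 ≤ ∑' m, ‖f m‖ ^ 2 := tsum_nonneg fun _ => by positivity
  rw [sub_self, mul_zero, mul_zero, add_zero] at hfin
  linarith

/-- Every square summable sequence is the sequence of samples at balanced nodes. -/
lemma exists_interpolation {a b : ℂ} (ha : 0 < a.re) (hb : 0 < b.re) {L ρ K κ : ℝ}
    (hρ : 0 < ρ) (hρ1 : ρ ≤ 1) (hκ : (a.re + b.re) * κ < min a.re b.re) {u : ℤ → ℝ}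
    (hu : IsBalancedAlong u L ρ K κ) {v : ℤ → ℂ} (hv : Summable fun n => ‖v n‖ ^ 2) :
    ∃ c : ℤ → ℂ, (Summable fun n => ‖c n‖ ^ 2) ∧
      ∀ m, HasSum (fun n : ℤ => c n * gen a b (u m - n)) (v m) := by
  obtain ⟨D, d, hD, hd, hinv⟩ := exists_finite_inverse ha hb hρ hρ1 hκ (L := L) (K := K)
  obtain ⟨I, hI, hbal⟩ := hu
  choose H hH hright _ using fun N => hinv u (I N) (hbal N)
  set T := (D * expSum d) ^ 2 * ∑' n, ‖v n‖ ^ 2 with hT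
  set cN : ℕ → ℤ → ℂ := fun N n => if n ∈ I N then ∑ m ∈ I N, H N n m * v m else 0 with hcN
  have hT0 : ∀ N, ∑ n ∈ I N, ‖cN N n‖ ^ 2 ≤ T := by
    intro N
    refine le_trans (Finset.sum_le_sum fun n hn => ?_)
      ((schur_exp hd hD (I N) (I N) (H N) (hH N) v).trans (mul_le_mul_of_nonneg_left
        (hv.sum_le_tsum (I N) fun _ _ => by positivity) (by positivity)))
    simp [hcN, hn]
  have hTJ : ∀ N (J : Finset ℤ), ∑ n ∈ J, ‖cN N n‖ ^ 2 ≤ T := by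
    intro N J
    refine le_trans ?_ (hT0 N)
    have h1 : ∑ n ∈ J, ‖cN N n‖ ^ 2 = ∑ n ∈ J with n ∈ I N, ‖cN N n‖ ^ 2 := by
      refine (Finset.sum_filter_of_ne fun n _ hn => ?_).symm
      by_contra h
      exact hn (by simp [hcN, h])
    rw [h1]
    exact Finset.sum_le_sum_of_subset_of_nonneg (fun n hn => (Finset.mem_filter.1 hn).2)
      fun _ _ _ => by positivity
  have hbd : ∀ N n, ‖cN N n‖ ≤ √T := fun N n => norm_le_sqrt_of_sum_sq_le (hTJ N) n
  have hlim : ∀ n, ∃ z, Tendsto (fun N => cN N n) (hyperfilter ℕ : Filter ℕ) (nhds z) := by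
    intro n
    obtain ⟨z, -, hz⟩ := (isCompact_closedBall (0 : ℂ) √T).ultrafilter_le_nhds
      ((hyperfilter ℕ).map fun N => cN N n)
      (le_principal_iff.2 (Filter.mem_map.2 (Filter.univ_mem' fun N => by
        simpa using hbd N n)))
    exact ⟨z, hz⟩
  choose c hc using hlim
  have hcT : ∀ J : Finset ℤ, ∑ n ∈ J, ‖c n‖ ^ 2 ≤ T := fun J =>
    le_of_tendsto' (tendsto_finsetSum J fun n _ => (hc n).norm.pow 2) fun N => hTJ N J
  refine ⟨c, summable_of_sum_le (fun n => by positivity) hcT, fun m => ?_⟩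
  have hs := summable_mul_gen_sub ha hb (u m) (norm_le_sqrt_of_sum_sq_le hcT)
  have ht : Tendsto (fun N => ∑' n : ℤ, cN N n * gen a b (u m - n)) (hyperfilter ℕ : Filter ℕ)
      (nhds (∑' n : ℤ, c n * gen a b (u m - n))) := by
    refine tendsto_tsum_of_dominated_convergence
      ((summable_norm_gen_sub ha hb (u m)).mul_left √T) (fun n => (hc n).mul_const _) ?_
    refine Filter.Eventually.of_forall fun N n => ?_
    rw [norm_mul]
    exact mul_le_mul_of_nonneg_right (hbd N n) (norm_nonneg _)
  have hev : ∀ᶠ N in (hyperfilter ℕ : Filter ℕ),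
      ∑' n : ℤ, cN N n * gen a b (u m - n) = v m := by
    have h1 : ∀ᶠ N in (hyperfilter ℕ : Filter ℕ), {m} ≤ I N :=
      (Nat.hyperfilter_le_atTop) (hI.eventually_ge_atTop {m})
    filter_upwards [h1] with N hN
    have hm : m ∈ I N := hN (Finset.mem_singleton_self m)
    rw [tsum_eq_sum (s := I N) fun n hn => by simp [hcN, hn]]
    have h2 : ∀ n ∈ I N, cN N n * gen a b (u m - n) =
        ∑ k ∈ I N, gen a b (u m - n) * H N n k * v k := by
      intro n hn
      simp only [hcN, if_pos hn]
      rw [mul_comm, Finset.mul_sum]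
      exact Finset.sum_congr rfl fun k _ => by ring
    rw [Finset.sum_congr rfl h2, Finset.sum_comm]
    have h3 : ∀ k ∈ I N, ∑ n ∈ I N, gen a b (u m - n) * H N n k * v k =
        if m = k then v k else 0 := by
      intro k hk
      rw [← Finset.sum_mul, hright N m hm k hk, boole_mul]
    rw [Finset.sum_congr rfl h3]
    simp [hm]
  have heq : ∑' n : ℤ, c n * gen a b (u m - n) = v m :=
    tendsto_nhds_unique ht ((tendsto_congr' hev).2 tendsto_const_nhds)
  exact heq ▸ hs.hasSum

/-! ### Comparison of the coefficient norm with the `L²` norm -/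

lemma abs_discrepancy_shift_le {t : ℝ} (ht0 : 0 ≤ t) (ht1 : t ≤ 1) (I : Finset ℤ) {x y : ℝ}
    (hyx : y ≤ x) :
    |discrepancy (fun k => k + t) I x - discrepancy (fun k => k + t) I y| ≤
      2 + t * |x - y| := by
  have hterm : ∀ k : ℤ, |(max x (k : ℝ) - max x (k + t)) - (max y (k : ℝ) - max y (k + t))| ≤
      if k ∈ Finset.Icc ⌈y - t⌉ ⌊x⌋ then t else 0 := by
    intro k
    split_ifs with h
    · rw [abs_le]
      constructor <;> grind
    · have hk : x ≤ k ∨ k + t ≤ y := by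
        by_contra! hcon
        exact h (Finset.mem_Icc.2 ⟨Int.ceil_le.2 (by linarith), Int.le_floor.2 hcon.1.le⟩)
      rw [abs_nonpos_iff]
      rcases hk with hk | hk
      · rw [max_eq_right hk, max_eq_right (by linarith), max_eq_right (by linarith),
          max_eq_right (by linarith)]
        ring
      · rw [max_eq_left (by linarith), max_eq_left (by linarith), max_eq_left (by linarith),
          max_eq_left (by linarith)]
        ring
  rw [discrepancy, discrepancy, ← Finset.sum_sub_distrib]
  refine (Finset.abs_sum_le_sum_abs _ _).trans ((Finset.sum_le_sum fun k _ => hterm k).trans ?_)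
  rw [← Finset.sum_filter, Finset.sum_const, nsmul_eq_mul]
  have hcard : ((I.filter fun k => k ∈ Finset.Icc ⌈y - t⌉ ⌊x⌋).card : ℝ) ≤ x - y + 2 := by
    have h1 : (I.filter fun k => k ∈ Finset.Icc ⌈y - t⌉ ⌊x⌋).card ≤
        (Finset.Icc ⌈y - t⌉ ⌊x⌋).card :=
      Finset.card_le_card fun k hk => (Finset.mem_filter.1 hk).2
    rw [Int.card_Icc] at h1
    have h2 : (((⌊x⌋ + 1 - ⌈y - t⌉).toNat : ℤ) : ℝ) ≤ x - y + 2 := by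
      rw [Int.toNat_eq_max]
      push_cast
      refine max_le ?_ (by linarith)
      linarith [Int.floor_le x, Int.le_ceil (y - t)]
    refine le_trans (Nat.cast_le.2 h1) ?_
    exact_mod_cast h2
  rw [abs_of_nonneg (by linarith)]
  nlinarith

lemma isBalancedAlong_shift {t τ : ℝ} (ht0 : 0 ≤ t) (htτ : t ≤ τ) (hτ : τ ≤ 1) :
    IsBalancedAlong (fun k => k + t) 1 1 2 τ := by
  refine ⟨fun N => Finset.Icc (-N : ℤ) N, ?_, fun N => ⟨fun k => ?_, fun m k => ?_, ?_⟩⟩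
  · refine tendsto_atTop_finset_of_monotone (fun N M h => ?_) fun k => ⟨k.natAbs, ?_⟩
    · exact Finset.Icc_subset_Icc (by simpa using h) (by simpa using h)
    · rw [Finset.mem_Icc]
      omega
  · rw [add_sub_cancel_left, abs_of_nonneg ht0]
    linarith
  · rw [one_mul, add_sub_add_right_eq_sub]
  · intro x y
    have hmul : t * |x - y| ≤ τ * |x - y| := mul_le_mul_of_nonneg_right htτ (abs_nonneg _)
    rcases le_total y x with h | h
    · have := abs_discrepancy_shift_le ht0 (htτ.trans hτ) (Finset.Icc (-N : ℤ) N) h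
      linarith
    · have := abs_discrepancy_shift_le ht0 (htτ.trans hτ) (Finset.Icc (-N : ℤ) N) h
      rw [abs_sub_comm, abs_sub_comm y x] at this
      linarith

lemma lintegral_eq_lintegral_tsum_int {F : ℝ → ENNReal} (hF : Measurable F) :
    ∫⁻ x, F x = ∫⁻ t in Set.Ioc (0 : ℝ) 1, ∑' n : ℤ, F (n + t) := by
  rw [lintegral_tsum (f := fun (n : ℤ) t => F (n + t))
      fun n => (hF.comp (measurable_const_add _)).aemeasurable,
    ← setLIntegral_univ, ← iUnion_Ioc_add_intCast (0 : ℝ),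
    lintegral_iUnion (fun n => measurableSet_Ioc) (Set.pairwise_disjoint_Ioc_add_intCast (0 : ℝ))]
  refine tsum_congr fun n => ?_
  have h := (measurePreserving_add_left volume (n : ℝ)).setLIntegral_comp_preimage
    (measurableSet_Ioc (a := (0 : ℝ) + n) (b := 0 + n + 1)) hF
  rw [← h]
  congr 2
  ext x
  simp only [Set.mem_preimage, Set.mem_Ioc]
  constructor <;> rintro ⟨h1, h2⟩ <;> constructor <;> linarith

/-- The `L²` norm of a function in the shift-invariant space is comparable with the `ℓ²` norm
of its coefficients. -/
lemma exists_integral_bounds {a b : ℂ} (ha : 0 < a.re) (hb : 0 < b.re) :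
    ∃ C D : ℝ, 0 < C ∧ 0 < D ∧ ∀ (c : ℤ → ℂ) (f : ℝ → ℂ), (Summable fun n => ‖c n‖ ^ 2) →
      (∀ x : ℝ, HasSum (fun n : ℤ => c n * gen a b (x - n)) (f x)) →
      ∫ x, ‖f x‖ ^ 2 ≤ C * ∑' n, ‖c n‖ ^ 2 ∧ ∑' n, ‖c n‖ ^ 2 ≤ D * ∫ x, ‖f x‖ ^ 2 := by
  have hσ : 0 < a.re + b.re := add_pos ha hb
  have hmin : 0 < min a.re b.re := lt_min ha hb
  set τ := min 1 (min a.re b.re / (2 * (a.re + b.re))) with hτ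
  have hτ0 : 0 < τ := lt_min one_pos (by positivity)
  have hκ : (a.re + b.re) * τ < min a.re b.re := by
    have h1 : τ ≤ min a.re b.re / (2 * (a.re + b.re)) := min_le_right _ _
    rw [le_div_iff₀ (by positivity)] at h1
    linarith
  obtain ⟨E, hE, hup⟩ := exists_sampling_upper ha hb 1
  obtain ⟨G, hG, hlow⟩ := exists_sampling_lower ha hb one_pos le_rfl hκ (L := 1) (K := 2)
  refine ⟨E + 1, G / τ, by positivity, by positivity, fun c f hc hf => ?_⟩
  set T := ∑' n, ‖c n‖ ^ 2 with hT
  have hT0 : 0 ≤ T := tsum_nonneg fun _ => by positivity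
  have hmeas : Measurable f := by
    refine measurable_of_tendsto_metrizable' (f := fun (J : Finset ℤ) (x : ℝ) =>
      ∑ n ∈ J, c n * gen a b (x - n)) atTop (fun J => ?_) (tendsto_pi_nhds.2 hf)
    have := continuous_gen ha hb
    exact Continuous.measurable (by fun_prop)
  set F : ℝ → ENNReal := fun x => ENNReal.ofReal (‖f x‖ ^ 2) with hF
  have hFm : Measurable F := by fun_prop
  have hvals : ∀ t : ℝ, ∀ m : ℤ,
      HasSum (fun n : ℤ => c n * gen a b ((m + t : ℝ) - n)) (f (m + t)) := fun t m => hf _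
  have hnear : ∀ t ∈ Set.Ioc (0 : ℝ) 1, ∀ k : ℤ, |(k + t : ℝ) - k| ≤ 1 := fun t ht k => by
    rw [add_sub_cancel_left, abs_of_pos ht.1]
    exact ht.2
  have htsum : ∀ t ∈ Set.Ioc (0 : ℝ) 1,
      ∑' n : ℤ, F (n + t) = ENNReal.ofReal (∑' n : ℤ, ‖f (n + t)‖ ^ 2) := fun t ht =>
    (ENNReal.ofReal_tsum_of_nonneg (fun _ => by positivity)
      (hup (fun k => k + t) (hnear t ht) c (fun m => f (m + t)) hc (hvals t)).1).symm
  have hle : ∫⁻ x, F x ≤ ENNReal.ofReal (E * T) := by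
    rw [lintegral_eq_lintegral_tsum_int hFm]
    refine (setLIntegral_mono measurable_const fun t ht => (htsum t ht).trans_le
      (ENNReal.ofReal_le_ofReal
        (hup (fun k => k + t) (hnear t ht) c (fun m => f (m + t)) hc (hvals t)).2)).trans ?_
    simp [hT]
  have hge : ENNReal.ofReal (T / G * τ) ≤ ∫⁻ x, F x := by
    rw [lintegral_eq_lintegral_tsum_int hFm]
    have hsub : Set.Ioc (0 : ℝ) τ ⊆ Set.Ioc 0 1 := Set.Ioc_subset_Ioc_right (min_le_left _ _)
    refine le_trans ?_ (lintegral_mono_set hsub)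
    have hconst : ENNReal.ofReal (T / G * τ) =
        ∫⁻ _ in Set.Ioc (0 : ℝ) τ, ENNReal.ofReal (T / G) := by
      rw [setLIntegral_const, Real.volume_Ioc, sub_zero,
        ENNReal.ofReal_mul (by positivity)]
    rw [hconst]
    refine setLIntegral_mono' measurableSet_Ioc fun t ht => ?_
    rw [htsum t (hsub ht)]
    refine ENNReal.ofReal_le_ofReal ((div_le_iff₀' hG).2 ?_)
    exact hlow (fun k => k + t) (isBalancedAlong_shift ht.1.le ht.2 (min_le_left _ _)) c
      (fun m => f (m + t)) hc (hvals t)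
  have hnorm : ∫ x, ‖f x‖ ^ 2 = (∫⁻ x, F x).toReal :=
    integral_eq_lintegral_of_nonneg_ae (Filter.Eventually.of_forall fun _ => by positivity)
      (by fun_prop)
  rw [hnorm]
  constructor
  · refine (ENNReal.toReal_le_of_le_ofReal (by positivity) hle).trans ?_
    nlinarith
  · have h1 := (ENNReal.ofReal_le_iff_le_toReal (hle.trans_lt ENNReal.ofReal_lt_top).ne).1 hge
    have h2 : T = G / τ * (T / G * τ) := by field_simp
    rw [h2]
    exact mul_le_mul_of_nonneg_left h1 (by positivity)

/-! ### Counting points of a separated set -/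

lemma finite_and_ncard_le_of_sep {Λ : Set ℝ} {δ : ℝ} (hδ : 0 < δ)
    (h : ∀ x ∈ Λ, ∀ y ∈ Λ, x ≠ y → δ ≤ |x - y|) (x : ℝ) {r : ℝ} (hr : 0 ≤ r) :
    (Λ ∩ Set.Icc x (x + r)).Finite ∧ ((Λ ∩ Set.Icc x (x + r)).ncard : ℝ) ≤ r / δ + 2 := by
  set t : Finset ℤ := Finset.Icc ⌊x / δ⌋ ⌊(x + r) / δ⌋ with ht
  have hmaps : ∀ y ∈ Λ ∩ Set.Icc x (x + r), ⌊y / δ⌋ ∈ (t : Set ℤ) := by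
    rintro y ⟨-, h1, h2⟩
    rw [Finset.mem_coe, Finset.mem_Icc]
    exact ⟨Int.floor_mono (by gcongr), Int.floor_mono (by gcongr)⟩
  have hinj : Set.InjOn (fun y : ℝ => ⌊y / δ⌋) (Λ ∩ Set.Icc x (x + r)) := by
    rintro y ⟨hy, -⟩ z ⟨hz, -⟩ hyz
    by_contra hne
    have h1 := h y hy z hz hne
    have h2 := Int.abs_sub_lt_one_of_floor_eq_floor hyz
    rw [← sub_div, abs_div, abs_of_pos hδ, div_lt_one hδ] at h2
    linarith
  refine ⟨Set.Finite.of_injOn hmaps hinj t.finite_toSet, ?_⟩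
  have h1 := Set.ncard_le_ncard_of_injOn _ hmaps hinj t.finite_toSet
  rw [Set.ncard_coe_finset, ht, Int.card_Icc] at h1
  refine le_trans (Nat.cast_le.2 h1) ?_
  have h2 : (((⌊(x + r) / δ⌋ + 1 - ⌊x / δ⌋).toNat : ℤ) : ℝ) ≤ r / δ + 2 := by
    rw [Int.toNat_eq_max]
    push_cast
    have h3 := Int.floor_le ((x + r) / δ)
    have h4 := Int.lt_floor_add_one (x / δ)
    have h5 : (x + r) / δ = x / δ + r / δ := add_div _ _ _
    refine max_le (by linarith) (by positivity)
  exact_mod_cast h2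

lemma exists_ncard_le_of_upperDensity_lt_one {Λ : Set ℝ} (hΛ : Separated Λ)
    (hd : upperDensity Λ < 1) :
    ∃ θ R : ℝ, 0 ≤ θ ∧ θ < 1 ∧ 0 ≤ R ∧ ∀ x l : ℝ, 0 ≤ l →
      ((Λ ∩ Set.Icc x (x + l)).ncard : ℝ) ≤ θ * l + R := by
  obtain ⟨δ, hδ, hsep⟩ := hΛ
  have hfin := fun x (r : ℝ) (hr : 0 ≤ r) => (finite_and_ncard_le_of_sep hδ hsep x hr).1
  obtain ⟨θ₀, h1, h2⟩ := exists_between hd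
  have hle : ∀ r : ℝ, 1 ≤ r → ∀ x : ℝ,
      ((Λ ∩ Set.Icc x (x + r)).ncard : ℝ) / r ≤ 1 / δ + 2 := by
    intro r hr x
    rw [div_le_iff₀ (by linarith)]
    refine (finite_and_ncard_le_of_sep hδ hsep x (by linarith)).2.trans ?_
    have : r / δ = 1 / δ * r := by ring
    nlinarith
  have hbdd : IsBoundedUnder (· ≤ ·) atTop
      (fun r : ℝ => ⨆ x : ℝ, ((Λ ∩ Set.Icc x (x + r)).ncard : ℝ) / r) :=
    ⟨1 / δ + 2, Filter.eventually_map.2 ((eventually_ge_atTop 1).mono fun r hr =>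
      ciSup_le (hle r hr))⟩
  obtain ⟨r, hr, hr1⟩ := ((eventually_lt_of_limsup_lt h1 hbdd).and
    (eventually_ge_atTop (1 : ℝ))).exists
  have hr0 : 0 < r := by linarith
  have hcount : ∀ x : ℝ, ((Λ ∩ Set.Icc x (x + r)).ncard : ℝ) ≤ max θ₀ 0 * r := by
    intro x
    have h3 : ((Λ ∩ Set.Icc x (x + r)).ncard : ℝ) / r ≤ θ₀ :=
      (le_ciSup (f := fun x : ℝ => ((Λ ∩ Set.Icc x (x + r)).ncard : ℝ) / r)
        ⟨1 / δ + 2, by rintro _ ⟨y, rfl⟩; exact hle r hr1 y⟩ x).trans hr.le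
    rw [div_le_iff₀ hr0] at h3
    nlinarith [le_max_left θ₀ 0]
  have hmul : ∀ (k : ℕ) (x : ℝ),
      ((Λ ∩ Set.Icc x (x + (k + 1) * r)).ncard : ℝ) ≤ (k + 1) * (max θ₀ 0 * r) := by
    intro k
    induction k with
    | zero => intro x; simpa using hcount x
    | succ k ih =>
      intro x
      have hsub : Λ ∩ Set.Icc x (x + ((k + 1 : ℕ) + 1) * r) ⊆
          (Λ ∩ Set.Icc x (x + (k + 1) * r)) ∪
            (Λ ∩ Set.Icc (x + (k + 1) * r) (x + (k + 1) * r + r)) := by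
        rintro y ⟨hy, hy1, hy2⟩
        push_cast at hy2
        rcases le_total y (x + (k + 1) * r) with h | h
        · exact Or.inl ⟨hy, hy1, h⟩
        · exact Or.inr ⟨hy, h, by linarith⟩
      have h4 := (Set.ncard_le_ncard hsub ((hfin _ _ (by positivity)).union
        (hfin _ _ hr0.le))).trans (Set.ncard_union_le _ _)
      have h5 : ((Λ ∩ Set.Icc x (x + ((k + 1 : ℕ) + 1) * r)).ncard : ℝ) ≤
          (Λ ∩ Set.Icc x (x + (k + 1) * r)).ncard +
            (Λ ∩ Set.Icc (x + (k + 1) * r) (x + (k + 1) * r + r)).ncard := by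
        exact_mod_cast h4
      have h6 := ih x
      have h7 := hcount (x + (k + 1) * r)
      push_cast at h5 ⊢
      linarith
  refine ⟨max θ₀ 0, max θ₀ 0 * r, le_max_right _ _, max_lt h2 one_pos, by positivity,
    fun x l hl => ?_⟩
  have h8 := Nat.floor_le (div_nonneg hl hr0.le)
  have h9 := Nat.lt_floor_add_one (l / r)
  rw [le_div_iff₀ hr0] at h8
  rw [div_lt_iff₀ hr0] at h9
  have hsub : Λ ∩ Set.Icc x (x + l) ⊆ Λ ∩ Set.Icc x (x + ((⌊l / r⌋₊ : ℝ) + 1) * r) :=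
    Set.inter_subset_inter_right _ (Set.Icc_subset_Icc_right (by linarith))
  have h10 : ((Λ ∩ Set.Icc x (x + l)).ncard : ℝ) ≤
      (Λ ∩ Set.Icc x (x + ((⌊l / r⌋₊ : ℝ) + 1) * r)).ncard := by
    exact_mod_cast Set.ncard_le_ncard hsub (hfin _ _ (by positivity))
  have h11 : (⌊l / r⌋₊ : ℝ) * r * max θ₀ 0 ≤ l * max θ₀ 0 :=
    mul_le_mul_of_nonneg_right h8 (le_max_right _ _)
  linarith [hmul ⌊l / r⌋₊ x]

/-- Summation by counting: a sum of values in `[0, B]` is controlled by the numbers of values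
exceeding the integers below `B`. -/
lemma sum_le_of_card_filter_le {F : Finset ℝ} {B : ℕ} {t : ℝ → ℝ} (ht : ∀ x ∈ F, t x ≤ B)
    {θ R : ℝ} (hcount : ∀ k < B, ((F.filter fun x => (k : ℝ) < t x).card : ℝ) ≤ θ * (B - k) + R) :
    ∑ x ∈ F, t x ≤ θ * (B * (B + 1) / 2) + R * B := by
  have h1 : ∀ x ∈ F, t x ≤ ∑ k ∈ Finset.range B, if (k : ℝ) < t x then (1 : ℝ) else 0 := by
    intro x hx
    rw [Finset.sum_boole]
    have hsub : Finset.range ⌈t x⌉₊ ⊆ (Finset.range B).filter fun k : ℕ => (k : ℝ) < t x := by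
      intro k hk
      rw [Finset.mem_range] at hk
      rw [Finset.mem_filter, Finset.mem_range]
      exact ⟨hk.trans_le (Nat.ceil_le.2 (ht x hx)), Nat.lt_ceil.1 hk⟩
    have h2 := Finset.card_le_card hsub
    rw [Finset.card_range] at h2
    exact (Nat.le_ceil _).trans (Nat.cast_le.2 h2)
  refine (Finset.sum_le_sum h1).trans ?_
  rw [Finset.sum_comm]
  have h2 : ∀ k ∈ Finset.range B, ∑ x ∈ F, (if (k : ℝ) < t x then (1 : ℝ) else 0) ≤
      θ * (B - k) + R := fun k hk => by
    rw [Finset.sum_boole]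
    exact hcount k (Finset.mem_range.1 hk)
  refine (Finset.sum_le_sum h2).trans (le_of_eq ?_)
  have h3 : ∀ n : ℕ, ∑ k ∈ Finset.range n, (k : ℝ) = n * (n - 1) / 2 := by
    intro n
    induction n with
    | zero => simp
    | succ n ih => rw [Finset.sum_range_succ, ih]; push_cast; ring
  rw [Finset.sum_add_distrib, ← Finset.mul_sum, Finset.sum_sub_distrib, h3]
  simp only [Finset.sum_const, Finset.card_range, nsmul_eq_mul]
  ring

/-! ### Tight clusters of points with a prescribed mean -/

lemma exists_offsets {p : ℕ} (hp : 2 ≤ p) {h : ℝ} (hh : 0 < h) (t : ℝ) :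
    ∃ e : ℕ → ℝ, ∑ j ∈ Finset.range p, e j = 0 ∧
      (∀ j < p, |e j| ≤ h * p ^ 2) ∧ (∀ j < p, h / 4 ≤ |t - e j|) ∧
      ∀ i < p, ∀ j < p, i ≠ j → h / 4 ≤ |e i - e j| := by
  have hp2 : (2 : ℝ) ≤ p := by exact_mod_cast hp
  set q : ℝ := p * (p - 1) / 2 with hq
  have hq1 : 1 ≤ q := by rw [hq]; nlinarith
  have hqp : q ≤ p ^ 2 := by rw [hq]; nlinarith
  obtain ⟨s, hs1, hs2, hs3⟩ : ∃ s : ℝ, h / 2 ≤ s ∧ s ≤ h ∧ h / 4 ≤ |(|t| - s * q)| := by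
    by_cases hc : h / 4 ≤ |(|t| - h * q)|
    · exact ⟨h, by linarith, le_rfl, hc⟩
    · refine ⟨h / 2, le_rfl, by linarith, ?_⟩
      have h1 := abs_lt.1 (not_le.1 hc)
      refine le_trans ?_ (le_abs_self _)
      nlinarith [h1.1]
  have hs0 : 0 < s := by linarith
  obtain ⟨ε, hε, hεt⟩ : ∃ ε : ℝ, |ε| = 1 ∧ t = ε * |t| := by
    rcases le_total 0 t with h | h
    · exact ⟨1, by simp, by rw [abs_of_nonneg h, one_mul]⟩
    · exact ⟨-1, by simp, by rw [abs_of_nonpos h]; ring⟩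
  set d : ℕ → ℝ := fun j => if j = 0 then q else -j with hd
  refine ⟨fun j => ε * (s * d j), ?_, fun j hj => ?_, fun j hj => ?_, fun i hi j hj hij => ?_⟩
  · have h1 : ∀ n : ℕ, ∑ j ∈ Finset.range (n + 1), d j = q - n * (n + 1) / 2 := by
      intro n
      induction n with
      | zero => simp [hd]
      | succ n ih =>
        rw [Finset.sum_range_succ, ih]
        simp only [hd, Nat.succ_ne_zero, if_false]
        push_cast
        ring
    obtain ⟨n, rfl⟩ : ∃ n, p = n + 1 := ⟨p - 1, by omega⟩
    rw [← Finset.mul_sum, ← Finset.mul_sum, h1, hq]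
    push_cast
    ring
  · rw [abs_mul, hε, one_mul, abs_mul, abs_of_pos hs0]
    refine mul_le_mul hs2 ?_ (abs_nonneg _) hh.le
    have hjp : (j : ℝ) ≤ p := by exact_mod_cast hj.le
    by_cases h0 : j = 0
    · simp only [hd, h0, if_true]
      rwa [abs_of_nonneg (by linarith)]
    · simp only [hd, h0, if_false, abs_neg, Nat.abs_cast]
      nlinarith
  · have h1 : |t - ε * (s * d j)| = |(|t| - s * d j)| := by
      conv_lhs => rw [hεt, ← mul_sub, abs_mul, hε, one_mul]
    rw [h1]
    by_cases h0 : j = 0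
    · simpa only [hd, h0, if_true] using hs3
    · simp only [hd, h0, if_false]
      have hj1 : (1 : ℝ) ≤ j := by exact_mod_cast Nat.one_le_iff_ne_zero.2 h0
      refine le_trans ?_ (le_abs_self _)
      nlinarith [abs_nonneg t]
  · have h1 : |ε * (s * d i) - ε * (s * d j)| = s * |d i - d j| := by
      rw [← mul_sub, ← mul_sub, abs_mul, hε, one_mul, abs_mul, abs_of_pos hs0]
    have h2 : 1 ≤ |d i - d j| := by
      by_cases hi0 : i = 0 <;> by_cases hj0 : j = 0
      · exact absurd (hi0.trans hj0.symm) hij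
      · simp only [hd, hi0, hj0, if_true, if_false]
        refine le_trans ?_ (le_abs_self _)
        have : (0 : ℝ) ≤ j := Nat.cast_nonneg j
        linarith
      · simp only [hd, hi0, hj0, if_true, if_false]
        refine le_trans ?_ (neg_le_abs _)
        have : (0 : ℝ) ≤ i := Nat.cast_nonneg i
        linarith
      · simp only [hd, hi0, hj0, if_false]
        have h3 : (i : ℤ) - j ≠ 0 := by omega
        have h4 : (1 : ℝ) ≤ |(i : ℝ) - j| := by exact_mod_cast Int.one_le_abs h3
        rw [show -(i : ℝ) - -j = -((i : ℝ) - j) by ring, abs_neg]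
        exact h4
    rw [h1]
    nlinarith

/-- A finite cluster of points near `y` with mean `y`, staying away from a separated set. -/
lemma exists_cluster {Λ : Set ℝ} {δ : ℝ} (hδ : 0 < δ)
    (hsep : ∀ x ∈ Λ, ∀ y ∈ Λ, x ≠ y → δ ≤ |x - y|) (B : ℕ) :
    ∃ η : ℝ, 0 < η ∧ η ≤ δ ∧ η ≤ 1 ∧ ∀ (p : ℕ) (y : ℝ), 2 ≤ p → p ≤ B →
      ∃ S : Finset ℝ, S.card = p ∧ ∑ x ∈ S, x = p * y ∧ (∀ x ∈ S, |x - y| ≤ 1 / 4) ∧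
        (∀ x ∈ S, ∀ l ∈ Λ, η ≤ |l - x|) ∧ ∀ x ∈ S, ∀ z ∈ S, x ≠ z → η ≤ |x - z| := by
  set h : ℝ := min δ 1 / (4 * (B + 1) ^ 2) with hh
  have hm0 : 0 < min δ 1 := lt_min hδ one_pos
  have hh0 : 0 < h := by positivity
  have hB1 : (1 : ℝ) ≤ (B + 1) ^ 2 := one_le_pow₀ (by linarith [(Nat.cast_nonneg B : (0 : ℝ) ≤ B)])
  have hhB : h * (B + 1) ^ 2 = min δ 1 / 4 := by
    rw [hh]
    field_simp
  have hhm : h ≤ min δ 1 / 4 := by nlinarith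
  refine ⟨h / 4, by positivity, by linarith [min_le_left δ 1], by linarith [min_le_right δ 1],
    fun p y hp hpB => ?_⟩
  have hpB' : h * (p : ℝ) ^ 2 ≤ min δ 1 / 4 := by
    rw [← hhB]
    refine mul_le_mul_of_nonneg_left (pow_le_pow_left₀ (Nat.cast_nonneg _) ?_ 2) hh0.le
    exact_mod_cast hpB.trans (Nat.le_succ B)
  obtain ⟨t, ht⟩ : ∃ t : ℝ, ∀ l ∈ Λ, |l - y| < δ / 2 → l - y = t := by
    by_cases hex : ∃ l ∈ Λ, |l - y| < δ / 2
    · obtain ⟨l, hl, hly⟩ := hex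
      refine ⟨l - y, fun l' hl' hly' => ?_⟩
      by_contra hne
      have h1 := hsep l' hl' l hl fun he => hne (by rw [he])
      have h2 := abs_sub_le l' y l
      rw [abs_sub_comm y l] at h2
      linarith
    · exact ⟨0, fun l hl hly => absurd ⟨l, hl, hly⟩ hex⟩
  obtain ⟨e, he0, heB, het, hesep⟩ := exists_offsets hp hh0 t
  have hinj : Set.InjOn (fun j => y + e j) (Finset.range p : Set ℕ) := by
    intro i hi j hj hij
    by_contra hne
    have h1 := hesep i (Finset.mem_range.1 hi) j (Finset.mem_range.1 hj) hne
    rw [add_left_cancel hij, sub_self, abs_zero] at h1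
    linarith
  refine ⟨(Finset.range p).image fun j => y + e j, ?_, ?_, ?_, ?_, ?_⟩
  · rw [Finset.card_image_of_injOn hinj, Finset.card_range]
  · rw [Finset.sum_image hinj, Finset.sum_add_distrib, he0]
    simp
  · simp only [Finset.forall_mem_image, Finset.mem_range]
    intro j hj
    rw [add_sub_cancel_left]
    linarith [heB j hj, min_le_right δ 1]
  · simp only [Finset.forall_mem_image, Finset.mem_range]
    intro j hj l hl
    by_cases hly : |l - y| < δ / 2
    · have h1 := het j hj
      rwa [← ht l hl hly, sub_sub] at h1
    · have h1 := abs_sub_abs_le_abs_sub (l - y) (e j)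
      rw [sub_sub] at h1
      linarith [heB j hj, min_le_left δ 1]
  · simp only [Finset.forall_mem_image, Finset.mem_range]
    intro i hi j hj hij
    rw [add_sub_add_left_eq_sub]
    exact hesep i hi j hj fun he => hij (by rw [he])

/-! ### Balanced completion of a sparse separated set -/

lemma sum_Ico_add_eq (s : ℤ) (B : ℕ) :
    ∑ k ∈ Finset.Ico s (s + B), (k : ℝ) = s * B + B * (B - 1) / 2 := by
  have h : ∀ n : ℕ, ∑ k ∈ Finset.Ico s (s + n), (k : ℝ) = s * n + n * (n - 1) / 2 := by
    intro n
    induction n with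
    | zero => simp
    | succ n ih =>
      have h1 : Finset.Ico s (s + (n + 1 : ℕ)) = insert (s + n) (Finset.Ico s (s + n)) := by
        ext k
        simp only [Finset.mem_Ico, Finset.mem_insert]
        omega
      rw [h1, Finset.sum_insert (by simp), ih]
      push_cast
      ring
  exact h B

/-- Completion of a sparse separated set inside one block of length `B`: the points of `Λ` in the
block are supplemented by a cluster, so that number and sum agree with those of the integers. -/
lemma exists_block {Λ : Set ℝ} {θ R η : ℝ} {B : ℕ} (hR : 0 ≤ R)
    (hfin : ∀ x l : ℝ, 0 ≤ l → (Λ ∩ Set.Icc x (x + l)).Finite)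
    (hcount : ∀ x l : ℝ, 0 ≤ l → ((Λ ∩ Set.Icc x (x + l)).ncard : ℝ) ≤ θ * l + R)
    (hB : 2 * R + 4 ≤ (1 - θ) * B) (hη : 0 < η)
    (hcluster : ∀ (p : ℕ) (y : ℝ), 2 ≤ p → p ≤ B →
      ∃ S : Finset ℝ, S.card = p ∧ ∑ x ∈ S, x = p * y ∧ (∀ x ∈ S, |x - y| ≤ 1 / 4) ∧
        (∀ x ∈ S, ∀ l ∈ Λ, η ≤ |l - x|) ∧ ∀ x ∈ S, ∀ z ∈ S, x ≠ z → η ≤ |x - z|) (s : ℤ) :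
    ∃ S C : Finset ℝ, S.card = B ∧ ∑ x ∈ S, x = ∑ k ∈ Finset.Ico s (s + B), (k : ℝ) ∧
      (∀ x ∈ S, x ∈ Λ ∨ x ∈ C) ∧ (∀ x ∈ S, (s : ℝ) ≤ x ∧ x < s + B) ∧
      (∀ x ∈ Λ, (s : ℝ) ≤ x → x < s + B → x ∈ S) ∧
      (∀ x ∈ C, s + 1 / 2 ≤ x ∧ x ≤ s + B - 1 / 2) ∧
      (∀ x ∈ C, ∀ l ∈ Λ, η ≤ |l - x|) ∧ ∀ x ∈ C, ∀ z ∈ C, x ≠ z → η ≤ |x - z| := by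
  classical
  have hB0 : (0 : ℝ) ≤ B := Nat.cast_nonneg B
  have hBθ : θ * B ≤ B - (2 * R + 4) := by linarith
  have hF : (Λ ∩ Set.Ico (s : ℝ) (s + B)).Finite :=
    (hfin s B hB0).subset (Set.inter_subset_inter_right _ Set.Ico_subset_Icc_self)
  set F := hF.toFinset with hFdef
  have hmemF : ∀ x, x ∈ F ↔ x ∈ Λ ∧ (s : ℝ) ≤ x ∧ x < s + B := fun x => by
    simp [hFdef]
  have hcard : ∀ (G : Finset ℝ) (x l : ℝ), 0 ≤ l → (G : Set ℝ) ⊆ Λ ∩ Set.Icc x (x + l) →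
      (G.card : ℝ) ≤ θ * l + R := by
    intro G x l hl hG
    have h1 := Set.ncard_le_ncard hG (hfin x l hl)
    rw [Set.ncard_coe_finset] at h1
    exact (Nat.cast_le.2 h1).trans (hcount x l hl)
  have hFcard : (F.card : ℝ) ≤ θ * B + R := hcard F s B hB0 fun x hx => by
    obtain ⟨h1, h2, h3⟩ := (hmemF x).1 hx
    exact ⟨h1, h2, h3.le⟩
  have hlow : ∑ x ∈ F, (x - s) ≤ θ * (B * (B + 1) / 2) + R * B := by
    refine sum_le_of_card_filter_le (fun x hx => ?_) fun k hk => ?_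
    · linarith [((hmemF x).1 hx).2.2]
    · have hkB : (k : ℝ) ≤ B := by exact_mod_cast hk.le
      refine hcard _ (s + k) _ (by linarith) fun x hx => ?_
      obtain ⟨h1, h2⟩ := Finset.mem_filter.1 hx
      obtain ⟨h3, h4, h5⟩ := (hmemF x).1 h1
      exact ⟨h3, by linarith, by linarith⟩
  have hup : ∑ x ∈ F, (s + B - x) ≤ θ * (B * (B + 1) / 2) + R * B := by
    refine sum_le_of_card_filter_le (fun x hx => ?_) fun k hk => ?_
    · linarith [((hmemF x).1 hx).2.1]
    · have hkB : (k : ℝ) ≤ B := by exact_mod_cast hk.le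
      refine hcard _ s _ (by linarith) fun x hx => ?_
      obtain ⟨h1, h2⟩ := Finset.mem_filter.1 hx
      obtain ⟨h3, h4, h5⟩ := (hmemF x).1 h1
      exact ⟨h3, by linarith, by linarith⟩
  have hM : θ * (B * (B + 1) / 2) + R * B ≤ B * (B - 1) / 2 - B := by nlinarith
  have hFB : F.card + 2 ≤ B := by
    have h1 : (F.card : ℝ) + 2 ≤ B := by linarith
    exact_mod_cast h1
  obtain ⟨p, hp⟩ : ∃ p, F.card + p = B := ⟨B - F.card, by omega⟩
  have hpR : (F.card : ℝ) + p = B := by exact_mod_cast hp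
  have hp2 : 2 ≤ p := by omega
  have hp0 : (0 : ℝ) < p := by exact_mod_cast (by omega : 0 < p)
  have hpB : (p : ℝ) ≤ B := by linarith [(Nat.cast_nonneg F.card : (0 : ℝ) ≤ F.card)]
  rw [Finset.sum_sub_distrib, Finset.sum_const, nsmul_eq_mul] at hlow hup
  set y : ℝ := (s * B + B * (B - 1) / 2 - ∑ x ∈ F, x) / p with hy
  have hpy : p * y = s * B + B * (B - 1) / 2 - ∑ x ∈ F, x := mul_div_cancel₀ _ hp0.ne'
  have hFc : (F.card : ℝ) = B - p := by linarith
  rw [hFc] at hlow hup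
  have hy1 : s + 1 ≤ y := by
    rw [hy, le_div_iff₀ hp0]
    nlinarith
  have hy2 : y ≤ s + B - 1 := by
    rw [hy, div_le_iff₀ hp0]
    nlinarith
  obtain ⟨C, hC1, hC2, hC3, hC4, hC5⟩ := hcluster p y hp2 (by omega)
  have hCy : ∀ x ∈ C, s + 1 / 2 ≤ x ∧ x ≤ s + B - 1 / 2 := fun x hx => by
    have := abs_le.1 (hC3 x hx)
    constructor <;> linarith
  have hdisj : Disjoint F C := by
    rw [Finset.disjoint_left]
    intro x hxF hxC
    have := hC4 x hxC x ((hmemF x).1 hxF).1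
    rw [sub_self, abs_zero] at this
    linarith
  refine ⟨F ∪ C, C, ?_, ?_, fun x hx => ?_, fun x hx => ?_, fun x h1 h2 h3 => ?_, hCy, hC4, hC5⟩
  · rw [Finset.card_union_of_disjoint hdisj, hC1, hp]
  · rw [Finset.sum_union hdisj, hC2, hpy, sum_Ico_add_eq]
    ring
  · exact (Finset.mem_union.1 hx).imp_left fun h => ((hmemF x).1 h).1
  · rcases Finset.mem_union.1 hx with h | h
    · exact ((hmemF x).1 h).2
    · have := hCy x h
      constructor <;> linarith
  · exact Finset.mem_union_left _ ((hmemF x).2 ⟨h1, h2, h3⟩)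

lemma exists_balanced_blocks {Λ : Set ℝ} (hΛ : Separated Λ) (hd : upperDensity Λ < 1) :
    ∃ (B : ℕ) (η : ℝ) (S : ℤ → Finset ℝ), 0 < B ∧ 0 < η ∧ η ≤ 1 ∧ (∀ j, (S j).card = B) ∧
      (∀ j, ∑ x ∈ S j, x = ∑ k ∈ Finset.Ico (j * B) (j * B + B), (k : ℝ)) ∧
      (∀ j, ∀ x ∈ S j, (j * B : ℝ) ≤ x ∧ x < j * B + B) ∧
      (∀ x ∈ Λ, ∃ j, x ∈ S j) ∧
      ∀ i j, ∀ x ∈ S i, ∀ y ∈ S j, x ≠ y → η ≤ |x - y| := by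
  obtain ⟨θ, R, -, hθ1, hR, hcount⟩ := exists_ncard_le_of_upperDensity_lt_one hΛ hd
  obtain ⟨δ, hδ, hsep⟩ := hΛ
  obtain ⟨B, hB⟩ := exists_nat_ge ((2 * R + 4) / (1 - θ))
  rw [div_le_iff₀' (by linarith)] at hB
  have hB0 : 0 < B := by
    rcases Nat.eq_zero_or_pos B with rfl | h
    · simp only [Nat.cast_zero, mul_zero] at hB
      linarith
    · exact h
  have hBR : (0 : ℝ) < B := by exact_mod_cast hB0
  obtain ⟨η, hη, hηδ, hη1, hcluster⟩ := exists_cluster hδ hsep B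
  choose S C h1 h2 h3 h4 h5 h6 h7 h8 using fun j : ℤ => exists_block hR
    (fun x l hl => (finite_and_ncard_le_of_sep hδ hsep x hl).1) hcount hB hη hcluster (j * B)
  push_cast at h4 h5 h6
  refine ⟨B, η, S, hB0, hη, hη1, h1, h2, h4, fun x hx => ⟨⌊x / B⌋, ?_⟩, ?_⟩
  · have h9 := Int.floor_le (x / B)
    have h10 := Int.lt_floor_add_one (x / B)
    rw [le_div_iff₀ hBR] at h9
    rw [div_lt_iff₀ hBR] at h10
    exact h5 _ x hx h9 (by linarith)
  · intro i j x hx y hy hxy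
    rcases h3 i x hx with hxΛ | hxC <;> rcases h3 j y hy with hyΛ | hyC
    · exact hηδ.trans (hsep x hxΛ y hyΛ hxy)
    · exact h7 j y hyC x hxΛ
    · rw [abs_sub_comm]
      exact h7 i x hxC y hyΛ
    · rcases lt_trichotomy i j with hij | rfl | hij
      · have h9 : (i : ℝ) * B + B ≤ j * B := by
          have h10 : (i : ℝ) + 1 ≤ j := by exact_mod_cast hij
          nlinarith
        rw [abs_sub_comm]
        refine le_trans ?_ (le_abs_self _)
        linarith [h6 i x hxC, h6 j y hyC]
      · exact h8 i x hxC y hyC hxy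
      · have h9 : (j : ℝ) * B + B ≤ i * B := by
          have h10 : (j : ℝ) + 1 ≤ i := by exact_mod_cast hij
          nlinarith
        refine le_trans ?_ (le_abs_self _)
        linarith [h6 i x hxC, h6 j y hyC]

lemma exists_bijOn_of_card_eq {s : Finset ℤ} {t : Finset ℝ} (h : s.card = t.card) :
    ∃ f : ℤ → ℝ, Set.BijOn f s t := by
  classical
  refine ⟨fun k => if hk : k ∈ s then (Finset.equivOfCardEq h ⟨k, hk⟩ : ℝ) else 0,
    fun k hk => ?_, fun k hk l hl hkl => ?_, fun x hx => ?_⟩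
  · rw [Finset.mem_coe] at hk
    simp only [hk, dif_pos]
    exact (Finset.equivOfCardEq h ⟨k, hk⟩).2
  · rw [Finset.mem_coe] at hk hl
    simp only [hk, hl, dif_pos] at hkl
    simpa using (Finset.equivOfCardEq h).injective (Subtype.ext hkl)
  · refine ⟨(Finset.equivOfCardEq h).symm ⟨x, hx⟩, Subtype.property _, ?_⟩
    simp

lemma mem_Ico_mul_iff_ediv_eq {B : ℕ} (hB : 0 < B) (j k : ℤ) :
    k ∈ Finset.Ico (j * B) (j * B + B) ↔ k / B = j := by
  have hBZ : (0 : ℤ) < B := by exact_mod_cast hB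
  rw [Finset.mem_Ico, Int.ediv_eq_iff_of_pos hBZ]

/-- Nodes filling each block of length `B` with exactly `B` points, with the same sum as the
integers of the block, have bounded discrepancy. -/
lemma abs_discrepancy_le_of_blocks {B : ℕ} (hB : 0 < B) {u : ℤ → ℝ}
    (hu : ∀ k : ℤ, ((k / B : ℤ) * B : ℝ) ≤ u k ∧ u k < (k / B : ℤ) * B + B)
    (hnear : ∀ k, |u k - k| ≤ B)
    (hsum : ∀ j : ℤ, ∑ k ∈ Finset.Ico (j * B) (j * B + B), u k =
      ∑ k ∈ Finset.Ico (j * B) (j * B + B), (k : ℝ)) (N : ℕ) (x : ℝ) :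
    |discrepancy u (Finset.Ico (-N * B : ℤ) (N * B)) x| ≤ B ^ 2 := by
  have hBR : (0 : ℝ) < B := by exact_mod_cast hB
  have hBZ : (0 : ℤ) < B := by exact_mod_cast hB
  have hk : ∀ k : ℤ, ((k / B : ℤ) * B : ℝ) ≤ k ∧ (k : ℝ) < (k / B : ℤ) * B + B := fun k => by
    have h := Finset.mem_Ico.1 ((mem_Ico_mul_iff_ediv_eq hB (k / B) k).2 rfl)
    exact ⟨by exact_mod_cast h.1, by exact_mod_cast h.2⟩
  have hfiber : ∀ j ∈ Finset.Ico (-N : ℤ) N,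
      (Finset.Ico (-N * B : ℤ) (N * B)).filter (fun k => k / B = j) =
        Finset.Ico (j * B) (j * B + B) := by
    intro j hj
    rw [Finset.mem_Ico] at hj
    ext k
    rw [Finset.mem_filter, ← mem_Ico_mul_iff_ediv_eq hB, Finset.mem_Ico, Finset.mem_Ico]
    refine ⟨fun h => h.2, fun h => ⟨⟨?_, ?_⟩, h⟩⟩
    · nlinarith
    · nlinarith
  have hmaps : ∀ k ∈ Finset.Ico (-N * B : ℤ) (N * B), k / B ∈ Finset.Ico (-N : ℤ) N := by
    intro k hk
    rw [Finset.mem_Ico] at hk ⊢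
    exact ⟨(Int.le_ediv_iff_mul_le hBZ).2 hk.1, (Int.ediv_lt_iff_lt_mul hBZ).2 hk.2⟩
  rw [discrepancy, ← Finset.sum_fiberwise_of_maps_to hmaps]
  have hblock : ∀ j ∈ Finset.Ico (-N : ℤ) N,
      |∑ k ∈ (Finset.Ico (-N * B : ℤ) (N * B)).filter (fun k => k / B = j),
        (max x (k : ℝ) - max x (u k))| ≤ if j = ⌊x / B⌋ then (B : ℝ) ^ 2 else 0 := by
    intro j hj
    rw [hfiber j hj]
    split_ifs with hjx
    · refine (Finset.abs_sum_le_sum_abs _ _).trans ((Finset.sum_le_card_nsmul _ _ (B : ℝ)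
        fun k _ => ?_).trans_eq ?_)
      · rw [max_comm x, max_comm x]
        refine (abs_max_sub_max_le_abs (k : ℝ) (u k) x).trans ?_
        rw [abs_sub_comm]
        exact hnear k
      · simp [sq]
    · rw [abs_nonpos_iff]
      rcases lt_or_gt_of_ne hjx with h | h
      · have h1 : (j : ℝ) * B + B ≤ x := by
          have h2 := (Int.le_floor (z := j + 1)).1 h
          rw [le_div_iff₀ hBR] at h2
          push_cast at h2
          linarith
        refine Finset.sum_eq_zero fun k hkj => ?_
        rw [mem_Ico_mul_iff_ediv_eq hB] at hkj
        have h3 := hk k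
        have h4 := hu k
        rw [hkj] at h3 h4
        rw [max_eq_left (by linarith), max_eq_left (by linarith), sub_self]
      · have h1 : x ≤ (j : ℝ) * B := by
          have h2 := (Int.floor_lt).1 h
          rw [div_lt_iff₀ hBR] at h2
          exact h2.le
        rw [← sub_eq_zero.2 (hsum j).symm, ← Finset.sum_sub_distrib]
        refine Finset.sum_congr rfl fun k hkj => ?_
        rw [mem_Ico_mul_iff_ediv_eq hB] at hkj
        have h3 := hk k
        have h4 := hu k
        rw [hkj] at h3 h4
        rw [max_eq_right (by linarith), max_eq_right (by linarith)]
  refine (Finset.abs_sum_le_sum_abs _ _).trans ((Finset.sum_le_sum hblock).trans ?_)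
  rw [Finset.sum_ite_eq']
  split_ifs
  · exact le_rfl
  · positivity

lemma exists_balanced_superset {Λ : Set ℝ} (hΛ : Separated Λ) (hd : upperDensity Λ < 1) :
    ∃ (u : ℤ → ℝ) (L ρ K : ℝ), 0 < ρ ∧ ρ ≤ 1 ∧ IsBalancedAlong u L ρ K 0 ∧ Λ ⊆ Set.range u := by
  obtain ⟨B, η, S, hB, hη, hη1, hcard, hsum, hmem, hcover, hsep⟩ :=
    exists_balanced_blocks hΛ hd
  have hBR : (1 : ℝ) ≤ B := by exact_mod_cast hB
  choose f hf using fun j : ℤ =>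
    exists_bijOn_of_card_eq (s := Finset.Ico (j * B) (j * B + B)) (t := S j) (by simp [hcard])
  set u : ℤ → ℝ := fun k => f (k / B) k with hu
  have huS : ∀ k : ℤ, u k ∈ S (k / B) := fun k =>
    (hf (k / B)).mapsTo ((mem_Ico_mul_iff_ediv_eq hB (k / B) k).2 rfl)
  have huf : ∀ j : ℤ, ∀ k ∈ Finset.Ico (j * B) (j * B + B), u k = f j k := fun j k hk => by
    rw [mem_Ico_mul_iff_ediv_eq hB] at hk
    rw [hu, ← hk]
  have hublock : ∀ k : ℤ, ((k / B : ℤ) * B : ℝ) ≤ u k ∧ u k < (k / B : ℤ) * B + B := fun k =>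
    hmem _ _ (huS k)
  have hnear : ∀ k : ℤ, |u k - k| ≤ B := fun k => by
    have h := Finset.mem_Ico.1 ((mem_Ico_mul_iff_ediv_eq hB (k / B) k).2 rfl)
    have h1 : ((k / B : ℤ) * B : ℝ) ≤ k := by exact_mod_cast h.1
    have h2 : (k : ℝ) < (k / B : ℤ) * B + B := by exact_mod_cast h.2
    have h3 := hublock k
    rw [abs_le]
    constructor <;> linarith
  have husum : ∀ j : ℤ, ∑ k ∈ Finset.Ico (j * B) (j * B + B), u k =
      ∑ k ∈ Finset.Ico (j * B) (j * B + B), (k : ℝ) := fun j => by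
    rw [← hsum j]
    exact Finset.sum_nbij (f j) (hf j).mapsTo (hf j).injOn (hf j).surjOn (huf j)
  have hne : ∀ m k : ℤ, m ≠ k → u m ≠ u k := by
    intro m k hmk he
    have h1 : m / B = k / B := by
      have hm := hublock m
      have hk := hublock k
      rw [he] at hm
      have h2 : ((m / B : ℤ) : ℝ) < (k / B : ℤ) + 1 := by nlinarith
      have h3 : ((k / B : ℤ) : ℝ) < (m / B : ℤ) + 1 := by nlinarith
      norm_cast at h2 h3
      omega
    refine hmk ((hf (k / B)).injOn ((mem_Ico_mul_iff_ediv_eq hB _ m).2 h1)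
      ((mem_Ico_mul_iff_ediv_eq hB _ k).2 rfl) ?_)
    rw [← huf _ _ ((mem_Ico_mul_iff_ediv_eq hB _ m).2 h1), he]
  refine ⟨u, B, η / (4 * B), 2 * B ^ 2, by positivity, ?_,
    ⟨fun N => Finset.Ico (-N * B : ℤ) (N * B), ?_, fun N => ⟨hnear, fun m k => ?_, fun x y => ?_⟩⟩, fun x hx => ?_⟩
  · rw [div_le_one (by positivity)]
    linarith
  · refine tendsto_atTop_finset_of_monotone (fun N M h => ?_) fun k => ⟨k.natAbs + 1, ?_⟩
    · have h1 : (N : ℤ) * B ≤ M * B := by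
        exact_mod_cast Nat.mul_le_mul_right B h
      exact Finset.Ico_subset_Ico (by linarith) h1
    · have h1 : (1 : ℤ) ≤ B := by exact_mod_cast hB
      have h2 : |k| < (k.natAbs + 1 : ℕ) := by
        push_cast
        exact lt_add_one _
      have h3 : ((k.natAbs + 1 : ℕ) : ℤ) ≤ (k.natAbs + 1 : ℕ) * B :=
        le_mul_of_one_le_right (by positivity) h1
      have h4 := abs_lt.1 (h2.trans_le h3)
      rw [Finset.mem_Ico]
      exact ⟨by linarith [h4.1], h4.2⟩
  · rcases eq_or_ne m k with rfl | hmk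
    · simp
    · have h1 := hsep _ _ _ (huS m) _ (huS k) (hne m k hmk)
      rw [div_mul_eq_mul_div, div_le_iff₀ (by positivity)]
      have h2 : |(m : ℝ) - k| ≤ |u m - u k| + 2 * B := by
        have h3 := abs_le.1 (hnear m)
        have h4 := abs_le.1 (hnear k)
        have h5 := abs_le.1 (le_refl |u m - u k|)
        rw [abs_le]
        constructor <;> linarith
      nlinarith
  · have h1 := abs_discrepancy_le_of_blocks hB hublock hnear husum N x
    have h2 := abs_discrepancy_le_of_blocks hB hublock hnear husum N y
    have h3 := abs_sub (discrepancy u (Finset.Ico (-N * B : ℤ) (N * B)) x)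
      (discrepancy u (Finset.Ico (-N * B : ℤ) (N * B)) y)
    linarith
  · obtain ⟨j, hj⟩ := hcover x hx
    obtain ⟨k, hk, hkx⟩ := (hf j).surjOn hj
    exact ⟨k, (huf j k hk).trans hkx⟩

lemma memlp_two_iff_summable {ι : Type*} {c : ι → ℂ} :
    Memℓp c 2 ↔ Summable fun n => ‖c n‖ ^ 2 := by
  rw [memℓp_gen_iff (by norm_num)]
  simp

/-- a separated set with upper Beurling density less than 1 can be appended to a
complete interpolating sequence for `V²(g)`. -/
theorem statement3 (a b : ℂ) (ha : 0 < a.re) (hb : 0 < b.re)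
    (g : ℝ → ℂ) (hg : ∀ x : ℝ, g x = 1 / (Complex.exp (a * x) + Complex.exp (-b * x)))
    (Λ : Set ℝ) (hΛ : Separated Λ) (hd : upperDensity Λ < 1) :
    ∃ Λ' : Set ℝ, Λ ⊆ Λ' ∧ IsSamplingSet g Λ' ∧ IsInterpolatingSet g Λ' := by
  obtain rfl : g = gen a b := funext fun x => by rw [hg, gen]
  obtain ⟨u, L, ρ, K, hρ, hρ1, hu, hsub⟩ := exists_balanced_superset hΛ hd
  have hκ : (a.re + b.re) * 0 < min a.re b.re := by
    rw [mul_zero]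
    exact lt_min ha hb
  have hbal : IsBalanced u (hu.choose 0) L ρ K 0 := hu.choose_spec.2 0
  have hinj : Function.Injective u := fun m k he => by
    by_contra hmk
    exact hbal.ne hρ hmk he
  refine ⟨Set.range u, hsub, ?_, fun v hv => ?_⟩
  · obtain ⟨E, hE, hup⟩ := exists_sampling_upper ha hb L
    obtain ⟨G, hG, hlow⟩ := exists_sampling_lower ha hb hρ hρ1 hκ (L := L) (K := K)
    obtain ⟨C, D, hC, hD, hnorm⟩ := exists_integral_bounds ha hb
    refine ⟨(C * G)⁻¹, (E + 1) * D, by positivity, by positivity, fun f hf => ?_⟩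
    obtain ⟨c, hc, hcf⟩ := hf
    rw [memlp_two_iff_summable] at hc
    have htsum : ∑' l : Set.range u, ‖f l‖ ^ 2 = ∑' m, ‖f (u m)‖ ^ 2 :=
      ((Equiv.ofInjective u hinj).tsum_eq fun l : Set.range u => ‖f l‖ ^ 2).symm
    rw [htsum]
    obtain ⟨h1, h2⟩ := hnorm c f hc hcf
    have h3 := (hup u hbal.near c (fun m => f (u m)) hc fun m => hcf _).2
    have h4 := hlow u hu c (fun m => f (u m)) hc fun m => hcf _
    have hT : 0 ≤ ∑' n, ‖c n‖ ^ 2 := tsum_nonneg fun _ => by positivity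
    constructor
    · rw [inv_mul_le_iff₀ (by positivity), mul_assoc]
      exact h1.trans (mul_le_mul_of_nonneg_left h4 hC.le)
    · rw [mul_assoc]
      refine h3.trans ((mul_le_mul_of_nonneg_right (by linarith : E ≤ E + 1) hT).trans ?_)
      exact mul_le_mul_of_nonneg_left h2 (by positivity)
  · rw [memlp_two_iff_summable] at hv
    obtain ⟨c, hc, hcv⟩ := exists_interpolation ha hb hρ hρ1 hκ hu
      (v := fun m => v ⟨u m, m, rfl⟩) ((Equiv.ofInjective u hinj).summable_iff.2 hv)
    refine ⟨fun x => ∑' n : ℤ, c n * gen a b (x - n),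
      ⟨c, memlp_two_iff_summable.2 hc, fun x => Summable.hasSum ?_⟩, ?_⟩
    · exact summable_mul_gen_sub ha hb x
        (norm_le_sqrt_of_sum_sq_le fun J => hc.sum_le_tsum J fun _ _ => by positivity)
    · rintro ⟨_, m, rfl⟩
      exact (hcv m).tsum_eq

end
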